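/- Let B(V) be a natural sub-Hopf algebra of T(V) over a field k of characteristic p. If there exists a natural k-linear transformation r : T(V) → B(V) with r restricted to B(V) the identity, and if for each n the indecomposables functor Q_nB is a natural retract of a free T_n-functor (T_n-projective), then the inclusion B(V) → T(V) admits a natural coalgebra retraction; i.e., B(V) is a natural coalgebra-split sub-Hopf algebra of T(V), and T(V) ≅ B(V) ⊗ C(V) as coalgebras for some natural coalgebra functor C. -/

import Mathlib

open TensorProduct

section
variable (k : Type) [Field k] (V : Type) [AddCommGroup V] [Module k V]

/-- The comultiplication `ψ` on `T(V)` making `V` primitive. -/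
noncomputable def psi : TensorAlgebra k V →ₐ[k] TensorAlgebra k V ⊗[k] TensorAlgebra k V :=
  TensorAlgebra.lift k
    ((Algebra.TensorProduct.includeLeft :
        TensorAlgebra k V →ₐ[k] TensorAlgebra k V ⊗[k] TensorAlgebra k V).toLinearMap.comp
        (TensorAlgebra.ι k) +
      (Algebra.TensorProduct.includeRight :
        TensorAlgebra k V →ₐ[k] TensorAlgebra k V ⊗[k] TensorAlgebra k V).toLinearMap.comp
        (TensorAlgebra.ι k))

/-- The counit of `T(V)` (projection onto tensor length `0`). -/
noncomputable def eps : TensorAlgebra k V →ₗ[k] k :=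
  (TensorAlgebra.algebraMapInv : TensorAlgebra k V →ₐ[k] k).toLinearMap

/-- The degree-`n` homogeneous component `T_n(V)`. -/
noncomputable def Tpiece (n : ℕ) : Submodule k (TensorAlgebra k V) :=
  LinearMap.range (TensorAlgebra.ι k : V →ₗ[k] TensorAlgebra k V) ^ n

end

/-- The functorial map `T(f)`. -/
noncomputable def Tmap (k : Type) [Field k] {V W : Type} [AddCommGroup V] [Module k V]
    [AddCommGroup W] [Module k W] (f : V →ₗ[k] W) :
    TensorAlgebra k V →ₐ[k] TensorAlgebra k W :=
  TensorAlgebra.lift k ((TensorAlgebra.ι k).comp f)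


section Basics
variable {k : Type} [Field k] {V W : Type} [AddCommGroup V] [Module k V]
  [AddCommGroup W] [Module k W]

/-- Left induction on the tensor algebra. -/
theorem tleft_ind {p : TensorAlgebra k V → Prop} (h1 : p 1)
    (hadd : ∀ x y, p x → p y → p (x + y)) (hsmul : ∀ (c : k) x, p x → p (c • x))
    (hmul : ∀ v x, p x → p (TensorAlgebra.ι k v * x)) : ∀ x, p x := by
  have key : ∀ x : TensorAlgebra k V, ∀ u, p u → p (x * u) := by
    intro x
    induction x using TensorAlgebra.induction with
    | algebraMap r =>
      intro u hu
      rw [← Algebra.smul_def]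
      exact hsmul _ _ hu
    | ι v => exact fun u hu => hmul v u hu
    | mul a b ha hb =>
      intro u hu
      rw [mul_assoc]
      exact ha _ (hb _ hu)
    | add a b ha hb =>
      intro u hu
      rw [add_mul]
      exact hadd _ _ (ha _ hu) (hb _ hu)
  intro x
  simpa using key x 1 h1

theorem psi_ι (v : V) : psi k V (TensorAlgebra.ι k v) =
    TensorAlgebra.ι k v ⊗ₜ[k] 1 + 1 ⊗ₜ[k] TensorAlgebra.ι k v := by
  simp [psi]

theorem Tmap_ι (f : V →ₗ[k] W) (v : V) :
    Tmap k f (TensorAlgebra.ι k v) = TensorAlgebra.ι k (f v) := by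
  simp [Tmap]

theorem eps_one : eps k V 1 = 1 := by simp [eps]

theorem eps_mul (x y : TensorAlgebra k V) : eps k V (x * y) = eps k V x * eps k V y := by
  simp [eps]

theorem eps_ι (v : V) : eps k V (TensorAlgebra.ι k v) = 0 := by
  simp [eps, TensorAlgebra.algebraMapInv]

theorem eps_Tmap (f : V →ₗ[k] W) (x : TensorAlgebra k V) :
    eps k W (Tmap k f x) = eps k V x := by
  induction x using tleft_ind with
  | h1 => simp [eps_one]
  | hadd x y hx hy => simp [hx, hy]
  | hsmul c x hx => simp [hx]
  | hmul v x hx => simp [eps_mul, Tmap_ι, eps_ι]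

theorem psi_Tmap (f : V →ₗ[k] W) (x : TensorAlgebra k V) :
    psi k W (Tmap k f x) =
      TensorProduct.map (Tmap k f).toLinearMap (Tmap k f).toLinearMap (psi k V x) := by
  have h : (psi k W).comp (Tmap k f) =
      (Algebra.TensorProduct.map (Tmap k f) (Tmap k f)).comp (psi k V) := by
    ext v
    simp [psi_ι, Tmap_ι]
  exact DFunLike.congr_fun h x

theorem Tmap_comp {U : Type} [AddCommGroup U] [Module k U] (f : V →ₗ[k] W) (g : W →ₗ[k] U)
    (x : TensorAlgebra k V) : Tmap k g (Tmap k f x) = Tmap k (g.comp f) x := by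
  have h : (Tmap k g).comp (Tmap k f) = Tmap k (g.comp f) := by
    ext v
    simp [Tmap_ι]
  exact DFunLike.congr_fun h x

/-- coassociativity -/
theorem psi_coassoc (x : TensorAlgebra k V) :
    TensorProduct.assoc k _ _ _
      (TensorProduct.map (psi k V).toLinearMap LinearMap.id (psi k V x)) =
      TensorProduct.map LinearMap.id (psi k V).toLinearMap (psi k V x) := by
  have h : ((Algebra.TensorProduct.assoc k k k _ _ _).toAlgHom.comp
      (Algebra.TensorProduct.map (psi k V) (AlgHom.id k _))).comp (psi k V) =
      (Algebra.TensorProduct.map (AlgHom.id k _) (psi k V)).comp (psi k V) := by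
    ext v
    simp [psi_ι, TensorProduct.add_tmul, TensorProduct.tmul_add, Algebra.TensorProduct.one_def,
      add_assoc]
  exact DFunLike.congr_fun h x

theorem psi_leftComm (x : TensorAlgebra k V) :
    TensorProduct.leftComm k _ _ _
      (TensorProduct.map LinearMap.id (psi k V).toLinearMap (psi k V x)) =
      TensorProduct.map LinearMap.id (psi k V).toLinearMap (psi k V x) := by
  have h : ((Algebra.TensorProduct.leftComm k _ _ _).toAlgHom.comp
      (Algebra.TensorProduct.map (AlgHom.id k _) (psi k V))).comp (psi k V) =
      (Algebra.TensorProduct.map (AlgHom.id k _) (psi k V)).comp (psi k V) := by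
    ext v
    simp [psi_ι, TensorProduct.tmul_add, Algebra.TensorProduct.one_def]
    abel
  exact DFunLike.congr_fun h x

theorem psi_middle (x : TensorAlgebra k V) :
    TensorProduct.tensorTensorTensorComm k _ _ _ _
      (TensorProduct.map (psi k V).toLinearMap (psi k V).toLinearMap (psi k V x)) =
      TensorProduct.map (psi k V).toLinearMap (psi k V).toLinearMap (psi k V x) := by
  have h : ((Algebra.TensorProduct.tensorTensorTensorComm k k k k _ _ _ _).toAlgHom.comp
      (Algebra.TensorProduct.map (psi k V) (psi k V))).comp (psi k V) =
      (Algebra.TensorProduct.map (psi k V) (psi k V)).comp (psi k V) := by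
    ext v
    simp [psi_ι, TensorProduct.add_tmul, TensorProduct.tmul_add, Algebra.TensorProduct.one_def]
    abel
  exact DFunLike.congr_fun h x

/-- `(ε ⊗ id) ∘ ψ = id` -/
theorem eps_psi (x : TensorAlgebra k V) :
    TensorProduct.lid k _ (TensorProduct.map (eps k V) LinearMap.id (psi k V x)) = x := by
  have h : ((Algebra.TensorProduct.lid k (TensorAlgebra k V)).toAlgHom.comp
      (Algebra.TensorProduct.map (TensorAlgebra.algebraMapInv) (AlgHom.id k _))).comp (psi k V) =
      AlgHom.id k _ := by
    ext v
    simp [psi_ι, TensorAlgebra.algebraMapInv]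
  exact DFunLike.congr_fun h x

theorem psi_eps (x : TensorAlgebra k V) :
    TensorProduct.rid k _ (TensorProduct.map LinearMap.id (eps k V) (psi k V x)) = x := by
  have h : ((Algebra.TensorProduct.rid k k (TensorAlgebra k V)).toAlgHom.comp
      (Algebra.TensorProduct.map (AlgHom.id k _) (TensorAlgebra.algebraMapInv))).comp (psi k V) =
      AlgHom.id k _ := by
    ext v
    simp [psi_ι, TensorAlgebra.algebraMapInv]
  exact DFunLike.congr_fun h x

/-- The image of `A ⊗ B` in the tensor product of ambient modules. -/
noncomputable def tens {M N : Type} [AddCommGroup M] [Module k M] [AddCommGroup N] [Module k N]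
    (A : Submodule k M) (B : Submodule k N) : Submodule k (M ⊗[k] N) :=
  Submodule.map₂ (TensorProduct.mk k M N) A B

section tens
variable {M N P : Type} [AddCommGroup M] [Module k M] [AddCommGroup N] [Module k N]
  [AddCommGroup P] [Module k P] {A A' : Submodule k M} {B B' : Submodule k N}

theorem tmul_mem_tens {a : M} {b : N} (ha : a ∈ A) (hb : b ∈ B) : a ⊗ₜ[k] b ∈ tens A B :=
  Submodule.apply_mem_map₂ _ ha hb

theorem tens_le {X : Submodule k (M ⊗[k] N)} (h : ∀ a ∈ A, ∀ b ∈ B, a ⊗ₜ[k] b ∈ X) :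
    tens A B ≤ X := Submodule.map₂_le.2 h

theorem tens_mono (h : A ≤ A') (h' : B ≤ B') : tens A B ≤ tens A' B' :=
  Submodule.map₂_le_map₂ h h'

theorem tens_eqOn {f g : M ⊗[k] N →ₗ[k] P}
    (h : ∀ a ∈ A, ∀ b ∈ B, f (a ⊗ₜ[k] b) = g (a ⊗ₜ[k] b)) {z} (hz : z ∈ tens A B) :
    f z = g z :=
  (tens_le (X := LinearMap.eqLocus f g) h) hz

theorem tens_maps {X : Submodule k P} {f : M ⊗[k] N →ₗ[k] P}
    (h : ∀ a ∈ A, ∀ b ∈ B, f (a ⊗ₜ[k] b) ∈ X) {z} (hz : z ∈ tens A B) : f z ∈ X :=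
  (tens_le (X := X.comap f) h) hz

theorem tens_eq_span : tens A B =
    Submodule.span k {z : M ⊗[k] N | ∃ a ∈ A, ∃ b ∈ B, z = a ⊗ₜ[k] b} := by
  rw [tens, Submodule.map₂_eq_span_image2]
  congr 1
  ext z
  simp only [Set.mem_image2, Set.mem_ofPred_eq, SetLike.mem_coe, TensorProduct.mk_apply, eq_comm]

theorem tens_top_top : tens (⊤ : Submodule k M) (⊤ : Submodule k N) = ⊤ :=
  TensorProduct.map₂_mk_top_top_eq_top k M N

theorem tens_eq_range : tens A B = LinearMap.range (TensorProduct.map A.subtype B.subtype) := by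
  rw [TensorProduct.range_map, tens, Submodule.range_subtype, Submodule.range_subtype]

end tens

/-- The length filtration. -/
noncomputable def Fil (k V : Type) [Field k] [AddCommGroup V] [Module k V] (n : ℕ) :
    Submodule k (TensorAlgebra k V) :=
  (1 ⊔ LinearMap.range (TensorAlgebra.ι k : V →ₗ[k] TensorAlgebra k V)) ^ n

theorem Fil_zero_mem {x : TensorAlgebra k V} (hx : x ∈ Fil k V 0) : ∃ c : k, x = c • 1 := by
  rw [Fil, pow_zero, Submodule.mem_one] at hx
  obtain ⟨c, rfl⟩ := hx
  exact ⟨c, Algebra.algebraMap_eq_smul_one c⟩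

theorem Fil_le_succ (n : ℕ) : Fil k V n ≤ Fil k V (n + 1) := by
  intro x hx
  rw [Fil, pow_succ']
  have h := Submodule.mul_mem_mul (Submodule.mem_sup_left (Submodule.one_le.1 le_rfl) :
    (1 : TensorAlgebra k V) ∈ 1 ⊔ LinearMap.range (TensorAlgebra.ι k : V →ₗ[k] _)) hx
  rw [one_mul] at h
  exact h

theorem Fil_mono : Monotone (Fil k V) := monotone_nat_of_le_succ Fil_le_succ

theorem one_mem_Fil (n : ℕ) : (1 : TensorAlgebra k V) ∈ Fil k V n := by
  refine Fil_mono (Nat.zero_le n) ?_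
  rw [Fil, pow_zero]
  exact Submodule.one_le.1 le_rfl

theorem ι_mul_mem_Fil {n : ℕ} (v : V) {x : TensorAlgebra k V} (hx : x ∈ Fil k V n) :
    TensorAlgebra.ι k v * x ∈ Fil k V (n + 1) := by
  rw [Fil, pow_succ']
  exact Submodule.mul_mem_mul (Submodule.mem_sup_right ⟨v, rfl⟩) hx

theorem ι_mem_Fil (n : ℕ) (v : V) : TensorAlgebra.ι k v ∈ Fil k V (n + 1) := by
  simpa using ι_mul_mem_Fil v (one_mem_Fil (k := k) n)

theorem Fil_succ_le {n : ℕ} {X : Submodule k (TensorAlgebra k V)} (h1 : Fil k V n ≤ X)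
    (h2 : ∀ v, ∀ x ∈ Fil k V n, TensorAlgebra.ι k v * x ∈ X) : Fil k V (n + 1) ≤ X := by
  rw [Fil, pow_succ', Submodule.mul_le]
  intro a ha x hx
  obtain ⟨c, hc, w, ⟨v, rfl⟩, rfl⟩ := Submodule.mem_sup.1 ha
  obtain ⟨c, rfl⟩ := Submodule.mem_one.1 hc
  rw [add_mul, ← Algebra.smul_def]
  exact X.add_mem (X.smul_mem _ (h1 hx)) (h2 v x hx)

theorem Fil_exhaust (x : TensorAlgebra k V) : ∃ n, x ∈ Fil k V n := by
  induction x using tleft_ind with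
  | h1 => exact ⟨0, one_mem_Fil 0⟩
  | hadd x y hx hy =>
    obtain ⟨n, hn⟩ := hx
    obtain ⟨m, hm⟩ := hy
    exact ⟨max n m, (Fil k V _).add_mem (Fil_mono (le_max_left _ _) hn)
      (Fil_mono (le_max_right _ _) hm)⟩
  | hsmul c x hx =>
    obtain ⟨n, hn⟩ := hx
    exact ⟨n, (Fil k V _).smul_mem _ hn⟩
  | hmul v x hx =>
    obtain ⟨n, hn⟩ := hx
    exact ⟨n + 1, ι_mul_mem_Fil v hn⟩

/-- reduced diagonal lowers the filtration -/
theorem psi_Fil_succ (n : ℕ) {x : TensorAlgebra k V} (hx : x ∈ Fil k V (n + 1)) :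
    ∃ w ∈ tens (Fil k V n) (Fil k V n), psi k V x = x ⊗ₜ[k] 1 + 1 ⊗ₜ[k] x + w := by
  suffices h : psi k V x - x ⊗ₜ[k] 1 - 1 ⊗ₜ[k] x ∈ tens (Fil k V n) (Fil k V n) from
    ⟨_, h, by abel⟩
  let L : TensorAlgebra k V →ₗ[k] TensorAlgebra k V ⊗[k] TensorAlgebra k V :=
    (psi k V).toLinearMap - (TensorProduct.mk k _ _).flip 1 - TensorProduct.mk k _ _ 1
  change L x ∈ _
  have hL : ∀ x, L x = psi k V x - x ⊗ₜ[k] 1 - 1 ⊗ₜ[k] x := fun x => rfl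
  revert x
  change Fil k V (n + 1) ≤ (tens (Fil k V n) (Fil k V n)).comap L
  have hone : ∀ n, L 1 ∈ tens (Fil k V n) (Fil k V n) := by
    intro n
    rw [hL, map_one, Algebra.TensorProduct.one_def, sub_self, zero_sub]
    exact Submodule.neg_mem _ (tmul_mem_tens (one_mem_Fil n) (one_mem_Fil n))
  induction n with
  | zero =>
    refine Fil_succ_le ?_ ?_
    · intro x hx
      obtain ⟨c, rfl⟩ := Fil_zero_mem hx
      exact Submodule.smul_mem _ _ (hone 0)
    · intro v x hx
      obtain ⟨c, rfl⟩ := Fil_zero_mem hx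
      rw [mul_smul_comm, mul_one]
      refine Submodule.smul_mem _ _ ?_
      rw [Submodule.mem_comap, hL, psi_ι, add_sub_cancel_left, sub_self]
      exact Submodule.zero_mem _
  | succ n ih =>
    refine Fil_succ_le ?_ ?_
    · exact ih.trans (Submodule.comap_mono (tens_mono (Fil_le_succ n) (Fil_le_succ n)))
    · intro v x hx
      have h := ih hx
      rw [Submodule.mem_comap] at h ⊢
      have e : L (TensorAlgebra.ι k v * x) = TensorAlgebra.ι k v ⊗ₜ[k] x +
          x ⊗ₜ[k] TensorAlgebra.ι k v +
          (LinearMap.mulLeft k (TensorAlgebra.ι k v ⊗ₜ[k] (1 : TensorAlgebra k V)) (L x) +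
          LinearMap.mulLeft k ((1 : TensorAlgebra k V) ⊗ₜ[k] TensorAlgebra.ι k v) (L x)) := by
        simp only [LinearMap.mulLeft_apply, hL, map_mul, psi_ι, mul_sub, add_mul,
          Algebra.TensorProduct.tmul_mul_tmul, one_mul, mul_one]
        abel
      rw [e]
      refine Submodule.add_mem _ (Submodule.add_mem _ ?_ ?_) (Submodule.add_mem _ ?_ ?_)
      · exact tmul_mem_tens (ι_mem_Fil n v) hx
      · exact tmul_mem_tens hx (ι_mem_Fil n v)
      · refine tens_maps ?_ h
        intro a ha b hb
        rw [LinearMap.mulLeft_apply, Algebra.TensorProduct.tmul_mul_tmul, one_mul]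
        exact tmul_mem_tens (ι_mul_mem_Fil v ha) (Fil_le_succ n hb)
      · refine tens_maps ?_ h
        intro a ha b hb
        rw [LinearMap.mulLeft_apply, Algebra.TensorProduct.tmul_mul_tmul, one_mul]
        exact tmul_mem_tens (Fil_le_succ n ha) (ι_mul_mem_Fil v hb)

theorem psi_Fil (n : ℕ) {x : TensorAlgebra k V} (hx : x ∈ Fil k V n) :
    psi k V x ∈ tens (Fil k V n) (Fil k V n) := by
  cases n with
  | zero =>
    obtain ⟨c, rfl⟩ := Fil_zero_mem hx
    rw [map_smul, map_one, Algebra.TensorProduct.one_def]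
    exact Submodule.smul_mem _ _ (tmul_mem_tens (one_mem_Fil 0) (one_mem_Fil 0))
  | succ n =>
    obtain ⟨w, hw, e⟩ := psi_Fil_succ n hx
    rw [e]
    refine Submodule.add_mem _ (Submodule.add_mem _ ?_ ?_)
      (tens_mono (Fil_le_succ n) (Fil_le_succ n) hw)
    · exact tmul_mem_tens hx (one_mem_Fil _)
    · exact tmul_mem_tens (one_mem_Fil _) hx

end Basics

section Degrees
variable {k : Type} [Field k] {V W : Type} [AddCommGroup V] [Module k V]
  [AddCommGroup W] [Module k W]

/-- shift action used to define the degree projections -/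
noncomputable def shiftAct (k V : Type) [Field k] [AddCommGroup V] [Module k V] :
    V →ₗ[k] Module.End k (ℕ → TensorAlgebra k V) :=
  LinearMap.mk₂ k (fun v h a => Nat.casesOn a 0 (fun a => TensorAlgebra.ι k v * h a))
    (by intros; funext a; cases a <;> simp [add_mul])
    (by intros; funext a; cases a <;> simp)
    (by intros; funext a; cases a <;> simp [mul_add])
    (by intros; funext a; cases a <;> simp)

/-- The projection to the degree `m` component. -/
noncomputable def dproj (k V : Type) [Field k] [AddCommGroup V] [Module k V] (m : ℕ) :
    TensorAlgebra k V →ₗ[k] TensorAlgebra k V :=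
  (LinearMap.proj m).comp ((LinearMap.applyₗ (Pi.single 0 1 : ℕ → TensorAlgebra k V)).comp
    (TensorAlgebra.lift k (shiftAct k V)).toLinearMap)

theorem dproj_zero_one : dproj k V 0 1 = 1 := by simp [dproj]
theorem dproj_succ_one (m : ℕ) : dproj k V (m + 1) 1 = 0 := by simp [dproj]
theorem dproj_zero_ι (v : V) (x : TensorAlgebra k V) :
    dproj k V 0 (TensorAlgebra.ι k v * x) = 0 := by simp [dproj, shiftAct]
theorem dproj_succ_ι (m : ℕ) (v : V) (x : TensorAlgebra k V) :
    dproj k V (m + 1) (TensorAlgebra.ι k v * x) = TensorAlgebra.ι k v * dproj k V m x := by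
  simp [dproj, shiftAct]

theorem dproj_Tmap (f : V →ₗ[k] W) (x : TensorAlgebra k V) :
    ∀ m, dproj k W m (Tmap k f x) = Tmap k f (dproj k V m x) := by
  induction x using tleft_ind with
  | h1 =>
    intro m
    cases m <;> simp [dproj_zero_one, dproj_succ_one]
  | hadd x y hx hy => intro m; simp [hx, hy]
  | hsmul c x hx => intro m; simp [hx]
  | hmul v x hx =>
    intro m
    cases m <;> simp [Tmap_ι, dproj_zero_ι, dproj_succ_ι, hx]

theorem dproj_mem (x : TensorAlgebra k V) : ∀ m, dproj k V m x ∈ Fil k V m := by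
  induction x using tleft_ind with
  | h1 =>
    intro m
    cases m
    · rw [dproj_zero_one]; exact one_mem_Fil 0
    · rw [dproj_succ_one]; exact Submodule.zero_mem _
  | hadd x y hx hy => intro m; rw [map_add]; exact Submodule.add_mem _ (hx m) (hy m)
  | hsmul c x hx => intro m; rw [map_smul]; exact Submodule.smul_mem _ _ (hx m)
  | hmul v x hx =>
    intro m
    cases m
    · rw [dproj_zero_ι]; exact Submodule.zero_mem _
    · rw [dproj_succ_ι]; exact ι_mul_mem_Fil v (hx _)

theorem dproj_high {n : ℕ} : ∀ {m : ℕ}, n < m → Fil k V n ≤ LinearMap.ker (dproj k V m) := by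
  induction n with
  | zero =>
    intro m hm x hx
    obtain ⟨c, rfl⟩ := Fil_zero_mem hx
    obtain ⟨m, rfl⟩ := Nat.exists_eq_succ_of_ne_zero hm.ne'
    rw [LinearMap.mem_ker, map_smul, Nat.succ_eq_add_one, dproj_succ_one, smul_zero]
  | succ n ih =>
    intro m hm
    refine Fil_succ_le (ih (by omega)) ?_
    intro v x hx
    obtain ⟨m, rfl⟩ := Nat.exists_eq_succ_of_ne_zero (Nat.ne_zero_of_lt hm)
    have := ih (m := m) (by omega) hx
    rw [LinearMap.mem_ker] at this ⊢
    rw [Nat.succ_eq_add_one, dproj_succ_ι, this, mul_zero]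

/-- truncation -/
noncomputable def trunc (k V : Type) [Field k] [AddCommGroup V] [Module k V] (n : ℕ) :
    TensorAlgebra k V →ₗ[k] TensorAlgebra k V :=
  ∑ m ∈ Finset.range (n + 1), dproj k V m

theorem trunc_mem (n : ℕ) (x : TensorAlgebra k V) : trunc k V n x ∈ Fil k V n := by
  rw [trunc, LinearMap.sum_apply]
  refine Submodule.sum_mem _ fun m hm => Fil_mono ?_ (dproj_mem x m)
  have := Finset.mem_range.1 hm
  omega

theorem trunc_succ_ι (n : ℕ) (v : V) (x : TensorAlgebra k V) :
    trunc k V (n + 1) (TensorAlgebra.ι k v * x) = TensorAlgebra.ι k v * trunc k V n x := by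
  simp only [trunc, LinearMap.sum_apply]
  rw [Finset.sum_range_succ', dproj_zero_ι, add_zero, Finset.mul_sum]
  exact Finset.sum_congr rfl fun m _ => dproj_succ_ι m v x

theorem trunc_eq_self (n : ℕ) : ∀ x ∈ Fil k V n, trunc k V n x = x := by
  induction n with
  | zero =>
    intro x hx
    obtain ⟨c, rfl⟩ := Fil_zero_mem hx
    simp [trunc, dproj_zero_one]
  | succ n ih =>
    change Fil k V (n + 1) ≤ LinearMap.eqLocus (trunc k V (n + 1)) LinearMap.id
    refine Fil_succ_le ?_ ?_
    · intro x hx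
      change trunc k V (n + 1) x = x
      rw [trunc, Finset.sum_range_succ, LinearMap.add_apply]
      have h := dproj_high (Nat.lt_succ_self n) hx
      rw [LinearMap.mem_ker] at h
      rw [h, add_zero]
      exact ih x hx
    · intro v x hx
      change trunc k V (n + 1) _ = _
      rw [trunc_succ_ι, ih x hx]
      rfl

theorem trunc_Tmap (n : ℕ) (f : V →ₗ[k] W) (x : TensorAlgebra k V) :
    trunc k W n (Tmap k f x) = Tmap k f (trunc k V n x) := by
  simp [trunc, dproj_Tmap]

theorem mem_Fil_of_dproj {n : ℕ} {x : TensorAlgebra k V}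
    (h : ∀ m, n < m → dproj k V m x = 0) : x ∈ Fil k V n := by
  obtain ⟨N, hN⟩ := Fil_exhaust x
  rw [← trunc_eq_self N x hN, trunc, LinearMap.sum_apply]
  refine Submodule.sum_mem _ fun m _ => ?_
  rcases lt_or_ge n m with h1 | h1
  · rw [h m h1]; exact Submodule.zero_mem _
  · exact Fil_mono h1 (dproj_mem x m)

/-- action used to extract words with a prescribed pattern of colours -/
noncomputable def colAct (k V : Type) [Field k] [AddCommGroup V] [Module k V] :
    (ℕ → V) →ₗ[k] Module.End k (ℕ → TensorAlgebra k V) :=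
  LinearMap.mk₂ k (fun w h a => TensorAlgebra.ι k (w a) * h (a + 1))
    (by intros; funext a; simp [add_mul])
    (by intros; funext a; simp)
    (by intros; funext a; simp [mul_add])
    (by intros; funext a; simp)

/-- extraction of the words coloured `a, a + 1, …, m - 1`. -/
noncomputable def colX (k V : Type) [Field k] [AddCommGroup V] [Module k V] (m a : ℕ) :
    TensorAlgebra k (ℕ → V) →ₗ[k] TensorAlgebra k V :=
  (LinearMap.proj a).comp ((LinearMap.applyₗ (Pi.single m 1 : ℕ → TensorAlgebra k V)).comp
    (TensorAlgebra.lift k (colAct k V)).toLinearMap)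

theorem colX_one (m a : ℕ) : colX k V m a 1 = if a = m then 1 else 0 := by
  simp [colX, Pi.single_apply]

theorem colX_ι (m a : ℕ) (w : ℕ → V) (x : TensorAlgebra k (ℕ → V)) :
    colX k V m a (TensorAlgebra.ι k w * x) = TensorAlgebra.ι k (w a) * colX k V m (a + 1) x := by
  simp [colX, colAct]

/-- restriction of colours -/
noncomputable def restr (k V : Type) [Field k] [AddCommGroup V] [Module k V] (A : Finset ℕ) :
    (ℕ → V) →ₗ[k] (ℕ → V) :=
  LinearMap.pi fun a => if a ∈ A then LinearMap.proj a else 0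

theorem restr_apply (A : Finset ℕ) (w : ℕ → V) (a : ℕ) :
    restr k V A w a = if a ∈ A then w a else 0 := by
  simp only [restr, LinearMap.pi_apply]
  split_ifs <;> simp

/-- the diagonal with colours `< m` -/
noncomputable def diagm (k V : Type) [Field k] [AddCommGroup V] [Module k V] (m : ℕ) :
    V →ₗ[k] (ℕ → V) :=
  ∑ a ∈ Finset.range m, LinearMap.single k (fun _ => V) a

theorem diagm_apply (m : ℕ) (v : V) (a : ℕ) : diagm k V m v a = if a < m then v else 0 := by
  simp [diagm, Pi.single_apply]

theorem colX_diagm (m : ℕ) (x : TensorAlgebra k V) :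
    ∀ j a, a + j = m → colX k V m a (Tmap k (diagm k V m) x) = dproj k V j x := by
  induction x using tleft_ind with
  | h1 =>
    intro j a h
    rw [map_one, colX_one]
    cases j
    · rw [dproj_zero_one, if_pos (by omega)]
    · rw [dproj_succ_one, if_neg (by omega)]
  | hadd x y hx hy => intro j a h; simp [hx j a h, hy j a h]
  | hsmul c x hx => intro j a h; simp [hx j a h]
  | hmul v x hx =>
    intro j a h
    rw [map_mul, Tmap_ι, colX_ι, diagm_apply]
    cases j with
    | zero => rw [dproj_zero_ι, if_neg (by omega), map_zero, zero_mul]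
    | succ j => rw [dproj_succ_ι, if_pos (by omega), hx j (a + 1) (by omega)]

theorem colX_restr {m l : ℕ} (hl : l < m) {A : Finset ℕ} (hA : l ∉ A)
    (x : TensorAlgebra k (ℕ → V)) :
    ∀ a, a ≤ l → colX k V m a (Tmap k (restr k V A) x) = 0 := by
  induction x using tleft_ind with
  | h1 =>
    intro a h
    rw [map_one, colX_one, if_neg (by omega)]
  | hadd x y hx hy => intro a h; simp [hx a h, hy a h]
  | hsmul c x hx => intro a h; simp [hx a h]
  | hmul v x hx =>
    intro a h
    rw [map_mul, Tmap_ι, colX_ι, restr_apply]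
    rcases h.eq_or_lt with rfl | h
    · rw [if_neg hA, map_zero, zero_mul]
    · rw [hx (a + 1) h, mul_zero]

/-- span of the elements using at most `n` colours -/
noncomputable def colSpan (k V : Type) [Field k] [AddCommGroup V] [Module k V] (n : ℕ) :
    Submodule k (TensorAlgebra k (ℕ → V)) :=
  Submodule.span k {y | ∃ A : Finset ℕ, A.card ≤ n ∧ Tmap k (restr k V A) y = y}

theorem diagm_mem_colSpan (m n : ℕ) :
    ∀ x ∈ Fil k V n, Tmap k (diagm k V m) x ∈ colSpan k V n := by
  have one_mem : ∀ n, (1 : TensorAlgebra k (ℕ → V)) ∈ colSpan k V n := fun n =>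
    Submodule.subset_span ⟨∅, by simp, by simp⟩
  induction n with
  | zero =>
    intro x hx
    obtain ⟨c, rfl⟩ := Fil_zero_mem hx
    rw [map_smul, map_one]
    exact Submodule.smul_mem _ _ (one_mem 0)
  | succ n ih =>
    change Fil k V (n + 1) ≤ (colSpan k V (n + 1)).comap (Tmap k (diagm k V m)).toLinearMap
    refine Fil_succ_le ?_ ?_
    · intro x hx
      refine Submodule.span_mono ?_ (ih x hx)
      rintro y ⟨A, hA, h⟩
      exact ⟨A, by omega, h⟩
    · intro v x hx
      change Tmap k (diagm k V m) _ ∈ colSpan k V (n + 1)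
      rw [map_mul, Tmap_ι]
      rw [diagm, LinearMap.sum_apply, map_sum, Finset.sum_mul]
      refine Submodule.sum_mem _ fun l _ => ?_
      have : colSpan k V n ≤ (colSpan k V (n + 1)).comap
          (LinearMap.mulLeft k (TensorAlgebra.ι k (LinearMap.single k (fun _ => V) l v))) := by
        refine Submodule.span_le.2 ?_
        rintro y ⟨A, hA, h⟩
        refine Submodule.subset_span ⟨insert l A, (Finset.card_insert_le _ _).trans (by omega), ?_⟩
        rw [LinearMap.mulLeft_apply, map_mul, Tmap_ι]
        congr 1
        · congr 1
          funext a
          rw [restr_apply]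
          by_cases ha : a = l
          · simp [ha]
          · simp [ha]
        · rw [← h, Tmap_comp]
          congr 2
          ext w a
          by_cases ha : a ∈ A <;> simp [restr_apply, ha]
      exact this (ih x hx)

/-- naturality of a family of linear endomorphisms -/
def IsNatural (φ : ∀ (V : Type) [AddCommGroup V] [Module k V],
    TensorAlgebra k V →ₗ[k] TensorAlgebra k V) : Prop :=
  ∀ (V W : Type) [AddCommGroup V] [Module k V] [AddCommGroup W] [Module k W]
    (f : V →ₗ[k] W) (x : TensorAlgebra k V), φ W (Tmap k f x) = Tmap k f (φ V x)

/-- natural linear endomorphisms preserve the length filtration -/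
theorem IsNatural.fil {φ : ∀ (V : Type) [AddCommGroup V] [Module k V],
    TensorAlgebra k V →ₗ[k] TensorAlgebra k V} (hφ : IsNatural φ) {n : ℕ}
    {x : TensorAlgebra k V} (hx : x ∈ Fil k V n) : φ V x ∈ Fil k V n := by
  refine mem_Fil_of_dproj fun m hm => ?_
  rw [← colX_diagm m (φ V x) m 0 (by omega), ← hφ]
  have h := diagm_mem_colSpan m n x hx
  have : colSpan k V n ≤ LinearMap.ker ((colX k V m 0).comp (φ (ℕ → V))) := by
    refine Submodule.span_le.2 ?_
    rintro y ⟨A, hA, hy⟩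
    obtain ⟨l, hl, hlA⟩ : ∃ l ∈ Finset.range m, l ∉ A := by
      refine Finset.exists_mem_notMem_of_card_lt_card ?_
      rw [Finset.card_range]
      omega
    rw [SetLike.mem_coe, LinearMap.mem_ker, LinearMap.comp_apply, ← hy, hφ]
    exact colX_restr (Finset.mem_range.1 hl) hlA _ 0 (Nat.zero_le _)
  exact this h

end Degrees

section Fmaps
variable {k : Type} [Field k] {V W : Type} [AddCommGroup V] [Module k V]
  [AddCommGroup W] [Module k W]

/-- `a ⊗ b ↦ g (v a) b` -/
noncomputable def mgv (g : TensorAlgebra k V →ₗ[k] TensorAlgebra k V) :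
    V →ₗ[k] (TensorAlgebra k V ⊗[k] TensorAlgebra k V →ₗ[k] TensorAlgebra k V) where
  toFun v := (LinearMap.mul' k _).comp
    (TensorProduct.map (g.comp (LinearMap.mulLeft k (TensorAlgebra.ι k v))) LinearMap.id)
  map_add' v w := by
    refine TensorProduct.ext' fun a b => ?_
    simp [add_mul]
  map_smul' c v := by
    refine TensorProduct.ext' fun a b => ?_
    simp

@[simp] theorem mgv_tmul (g : TensorAlgebra k V →ₗ[k] TensorAlgebra k V) (v : V)
    (a b : TensorAlgebra k V) :
    mgv g v (a ⊗ₜ[k] b) = g (TensorAlgebra.ι k v * a) * b := rfl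

/-- `a ⊗ b ↦ a' ⊗ m (a'' ⊗ b)` -/
noncomputable def Lam (m : TensorAlgebra k V ⊗[k] TensorAlgebra k V →ₗ[k] TensorAlgebra k V) :
    TensorAlgebra k V ⊗[k] TensorAlgebra k V →ₗ[k] TensorAlgebra k V ⊗[k] TensorAlgebra k V :=
  (TensorProduct.map LinearMap.id m).comp
    ((TensorProduct.assoc k _ _ _).toLinearMap.comp
      (TensorProduct.map (psi k V).toLinearMap LinearMap.id))

/-- the operators `L_v` -/
noncomputable def Lop (g : TensorAlgebra k V →ₗ[k] TensorAlgebra k V) :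
    V →ₗ[k] Module.End k (TensorAlgebra k V ⊗[k] TensorAlgebra k V) where
  toFun v := TensorProduct.map (LinearMap.mulLeft k (TensorAlgebra.ι k v)) LinearMap.id +
    Lam (mgv g v)
  map_add' v w := by
    refine TensorProduct.ext' fun a b => ?_
    have : Lam (mgv g (v + w)) = Lam (mgv g v) + Lam (mgv g w) := by
      rw [Lam, map_add, TensorProduct.map_add_right, LinearMap.add_comp]; rfl
    rw [this]
    simp [add_mul, TensorProduct.add_tmul]
    abel
  map_smul' c v := by
    refine TensorProduct.ext' fun a b => ?_
    have : Lam (mgv g (c • v)) = c • Lam (mgv g v) := by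
      rw [Lam, map_smul, TensorProduct.map_smul_right, LinearMap.smul_comp]; rfl
    rw [this]
    simp [TensorProduct.smul_tmul', map_smul]

/-- the map `H_g` -/
noncomputable def Hg (g : TensorAlgebra k V →ₗ[k] TensorAlgebra k V) :
    TensorAlgebra k V →ₗ[k] TensorAlgebra k V ⊗[k] TensorAlgebra k V :=
  (LinearMap.applyₗ ((1 : TensorAlgebra k V) ⊗ₜ[k] (1 : TensorAlgebra k V))).comp
    (TensorAlgebra.lift k (Lop g)).toLinearMap

/-- the map `F_g` -/
noncomputable def Fg (g : TensorAlgebra k V →ₗ[k] TensorAlgebra k V) :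
    TensorAlgebra k V →ₗ[k] TensorAlgebra k V :=
  (TensorProduct.lid k _).toLinearMap.comp
    ((TensorProduct.map (eps k V) LinearMap.id).comp (Hg g))

variable (g : TensorAlgebra k V →ₗ[k] TensorAlgebra k V)

theorem Hg_one : Hg g 1 = 1 ⊗ₜ[k] 1 := by simp [Hg]

theorem Hg_ι (v : V) (x : TensorAlgebra k V) :
    Hg g (TensorAlgebra.ι k v * x) =
      TensorProduct.map (LinearMap.mulLeft k (TensorAlgebra.ι k v)) LinearMap.id (Hg g x) +
        Lam (mgv g v) (Hg g x) := by
  simp only [Hg, LinearMap.comp_apply, AlgHom.toLinearMap_apply, map_mul,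
    TensorAlgebra.lift_ι_apply, LinearMap.applyₗ_apply_apply, Module.End.mul_apply]
  rfl

theorem Fg_one : Fg g 1 = 1 := by simp [Fg, Hg_one, eps_one]

theorem Fg_ι' (v : V) (x : TensorAlgebra k V) :
    Fg g (TensorAlgebra.ι k v * x) = mgv g v (Hg g x) := by
  rw [Fg, LinearMap.comp_apply, LinearMap.comp_apply, Hg_ι]
  generalize Hg g x = h
  have e1 : (TensorProduct.lid k _).toLinearMap.comp
      ((TensorProduct.map (eps k V) LinearMap.id).comp
        (TensorProduct.map (LinearMap.mulLeft k (TensorAlgebra.ι k v)) LinearMap.id +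
          Lam (mgv g v))) = mgv g v := by
    refine TensorProduct.ext' fun a b => ?_
    have e2 : ∀ d : TensorAlgebra k V ⊗[k] TensorAlgebra k V,
        TensorProduct.lid k _ (TensorProduct.map (eps k V) LinearMap.id
          (TensorProduct.map LinearMap.id (mgv g v) (TensorProduct.assoc k _ _ _ (d ⊗ₜ[k] b)))) =
        mgv g v ((TensorProduct.lid k _ (TensorProduct.map (eps k V) LinearMap.id d)) ⊗ₜ[k] b) := by
      intro d
      induction d with
      | zero => simp
      | add x y hx hy => simp only [TensorProduct.add_tmul, map_add, hx, hy]
      | tmul x y => simp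
    have e3 := e2 (psi k V a)
    rw [eps_psi] at e3
    simp only [LinearMap.comp_apply, LinearMap.add_apply, map_add, Lam, TensorProduct.map_tmul,
      LinearEquiv.coe_coe, AlgHom.toLinearMap_apply, LinearMap.id_apply, e3]
    simp [eps_mul, eps_ι]
  exact LinearMap.congr_fun e1 h

/-- `H_g = (id ⊗ F_g) ψ` -/
theorem Hg_eq (n : ℕ) : ∀ x ∈ Fil k V n,
    Hg g x = TensorProduct.map LinearMap.id (Fg g) (psi k V x) := by
  induction n with
  | zero =>
    intro x hx
    obtain ⟨c, rfl⟩ := Fil_zero_mem hx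
    simp [Hg_one, Algebra.TensorProduct.one_def, Fg_one]
  | succ n ih =>
    change Fil k V (n + 1) ≤ LinearMap.eqLocus (Hg g)
      ((TensorProduct.map LinearMap.id (Fg g)).comp (psi k V).toLinearMap)
    refine Fil_succ_le ih ?_
    intro v x hx
    change Hg g _ = TensorProduct.map LinearMap.id (Fg g) (psi k V _)
    rw [Hg_ι, ih x hx, map_mul, psi_ι]
    have e1 : TensorProduct.map LinearMap.id (Fg g)
          ((TensorAlgebra.ι k v ⊗ₜ[k] 1 + 1 ⊗ₜ[k] TensorAlgebra.ι k v) * psi k V x) =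
        TensorProduct.map (LinearMap.mulLeft k (TensorAlgebra.ι k v)) (Fg g) (psi k V x) +
        TensorProduct.map LinearMap.id
          ((Fg g).comp (LinearMap.mulLeft k (TensorAlgebra.ι k v))) (psi k V x) := by
      generalize psi k V x = d
      induction d with
      | zero => simp
      | add x y hx hy => simp only [mul_add, map_add, hx, hy]; abel
      | tmul x y => simp [add_mul]
    have e2 : TensorProduct.map LinearMap.id
          ((Fg g).comp (LinearMap.mulLeft k (TensorAlgebra.ι k v))) (psi k V x) =
        ((TensorProduct.map LinearMap.id ((mgv g v).comp
          (TensorProduct.map LinearMap.id (Fg g)))).comp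
          (TensorProduct.map LinearMap.id (psi k V).toLinearMap)) (psi k V x) := by
      refine tens_eqOn ?_ (psi_Fil n hx)
      intro a _ b hb
      simp [Fg_ι', ih b hb]
    rw [e1, e2, LinearMap.comp_apply, ← psi_coassoc]
    congr 1
    · generalize psi k V x = d
      induction d with
      | zero => simp
      | add x y hx hy => simp only [map_add, hx, hy]
      | tmul x y => simp
    · rw [Lam, LinearMap.comp_apply, LinearMap.comp_apply]
      generalize psi k V x = d
      induction d with
      | zero => simp
      | add x y hx hy => simp only [map_add, hx, hy]
      | tmul x y =>
        simp only [TensorProduct.map_tmul, LinearMap.id_apply, LinearEquiv.coe_coe]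
        generalize (psi k V).toLinearMap x = d
        induction d with
        | zero => simp
        | add x y hx hy => simp only [map_add, TensorProduct.add_tmul, hx, hy]
        | tmul a b => simp

theorem Fg_ι (v : V) (x : TensorAlgebra k V) :
    Fg g (TensorAlgebra.ι k v * x) =
      mgv g v (TensorProduct.map LinearMap.id (Fg g) (psi k V x)) := by
  obtain ⟨n, hn⟩ := Fil_exhaust x
  rw [Fg_ι', Hg_eq g n x hn]

theorem Fg_range {A : Subalgebra k (TensorAlgebra k V)} (hg : ∀ x, g x ∈ A) (x) :
    Fg g x ∈ A := by
  obtain ⟨n, hn⟩ := Fil_exhaust x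
  revert x
  induction n with
  | zero =>
    intro x hx
    obtain ⟨c, rfl⟩ := Fil_zero_mem hx
    rw [map_smul, Fg_one]
    exact A.smul_mem A.one_mem c
  | succ n ih =>
    change Fil k V (n + 1) ≤ (Subalgebra.toSubmodule A).comap (Fg g)
    refine Fil_succ_le ih ?_
    intro v x hx
    change Fg g _ ∈ Subalgebra.toSubmodule A
    rw [Fg_ι, ← LinearMap.comp_apply]
    refine tens_maps ?_ (psi_Fil n hx)
    intro a _ b hb
    exact A.mul_mem (hg _) (ih b hb)

theorem Fg_eps (hg : ∀ x, eps k V (g x) = 0) (x) : eps k V (Fg g x) = eps k V x := by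
  induction x using tleft_ind with
  | h1 => rw [Fg_one]
  | hadd x y hx hy => simp [hx, hy]
  | hsmul c x hx => simp [hx]
  | hmul v x hx =>
    rw [Fg_ι, eps_mul, eps_ι, zero_mul]
    generalize TensorProduct.map LinearMap.id (Fg g) (psi k V x) = d
    induction d with
    | zero => simp
    | add x y hx hy => simp only [map_add, hx, hy, add_zero]
    | tmul a b => simp [eps_mul, hg]

theorem Fg_nat {g' : TensorAlgebra k W →ₗ[k] TensorAlgebra k W} (f : V →ₗ[k] W)
    (hg : ∀ x, g' (Tmap k f x) = Tmap k f (g x)) (x) :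
    Fg g' (Tmap k f x) = Tmap k f (Fg g x) := by
  obtain ⟨n, hn⟩ := Fil_exhaust x
  revert x
  induction n with
  | zero =>
    intro x hx
    obtain ⟨c, rfl⟩ := Fil_zero_mem hx
    simp [Fg_one]
  | succ n ih =>
    change Fil k V (n + 1) ≤ LinearMap.eqLocus ((Fg g').comp (Tmap k f).toLinearMap)
      ((Tmap k f).toLinearMap.comp (Fg g))
    refine Fil_succ_le ih ?_
    intro v x hx
    change Fg g' (Tmap k f _) = Tmap k f (Fg g _)
    rw [Fg_ι, map_mul, Tmap_ι, Fg_ι, psi_Tmap]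
    have := tens_eqOn (f := (mgv g' (f v)).comp ((TensorProduct.map LinearMap.id (Fg g')).comp
        (TensorProduct.map (Tmap k f).toLinearMap (Tmap k f).toLinearMap)))
      (g := (Tmap k f).toLinearMap.comp ((mgv g v).comp (TensorProduct.map LinearMap.id (Fg g))))
      ?_ (psi_Fil n hx)
    · exact this
    intro a _ b hb
    simp [ih b hb, ← hg, Tmap_ι]

/-- `F_g` is a coalgebra map when `g` takes primitive values -/
theorem Fg_coalg (hg : ∀ x, psi k V (g x) = g x ⊗ₜ[k] 1 + 1 ⊗ₜ[k] g x) (x) :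
    psi k V (Fg g x) = TensorProduct.map (Fg g) (Fg g) (psi k V x) := by
  obtain ⟨n, hn⟩ := Fil_exhaust x
  revert x
  induction n with
  | zero =>
    intro x hx
    obtain ⟨c, rfl⟩ := Fil_zero_mem hx
    simp [Fg_one, Algebra.TensorProduct.one_def]
  | succ n ih =>
    change Fil k V (n + 1) ≤ LinearMap.eqLocus ((psi k V).toLinearMap.comp (Fg g))
      ((TensorProduct.map (Fg g) (Fg g)).comp (psi k V).toLinearMap)
    refine Fil_succ_le ih ?_
    intro v x hx
    change psi k V (Fg g _) = TensorProduct.map (Fg g) (Fg g) (psi k V _)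
    -- the two pieces
    let A : TensorAlgebra k V ⊗[k] (TensorAlgebra k V ⊗[k] TensorAlgebra k V) →ₗ[k]
        TensorAlgebra k V ⊗[k] TensorAlgebra k V :=
      (TensorProduct.map (mgv g v) LinearMap.id).comp
        (TensorProduct.assoc k _ _ _).symm.toLinearMap
    let B : TensorAlgebra k V ⊗[k] (TensorAlgebra k V ⊗[k] TensorAlgebra k V) →ₗ[k]
        TensorAlgebra k V ⊗[k] TensorAlgebra k V :=
      (TensorProduct.map LinearMap.id (mgv g v)).comp
        (TensorProduct.leftComm k _ _ _).toLinearMap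
    have hl : (Fg g).comp (LinearMap.mulLeft k (TensorAlgebra.ι k v)) =
        ((mgv g v).comp (TensorProduct.map LinearMap.id (Fg g))).comp (psi k V).toLinearMap := by
      ext y
      exact Fg_ι g v y
    have e0 : psi k V (Fg g (TensorAlgebra.ι k v * x)) =
        ((A + B).comp ((TensorProduct.map LinearMap.id (TensorProduct.map (Fg g) (Fg g))).comp
          (TensorProduct.map LinearMap.id (psi k V).toLinearMap))) (psi k V x) := by
      rw [Fg_ι]
      refine tens_eqOn (f := (psi k V).toLinearMap.comp ((mgv g v).comp
        (TensorProduct.map LinearMap.id (Fg g)))) ?_ (psi_Fil n hx)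
      intro a _ b hb
      simp only [LinearMap.comp_apply, TensorProduct.map_tmul, LinearMap.id_apply, mgv_tmul,
        AlgHom.toLinearMap_apply, map_mul, ih b hb, hg]
      generalize TensorProduct.map (Fg g) (Fg g) (psi k V b) = d
      induction d with
      | zero => simp
      | add x y hx hy => simp only [mul_add, TensorProduct.tmul_add, map_add, hx, hy]
      | tmul x y => simp [A, B, add_mul]
    have e1 : TensorProduct.map (Fg g) (Fg g) (psi k V (TensorAlgebra.ι k v * x)) =
        TensorProduct.map ((Fg g).comp (LinearMap.mulLeft k (TensorAlgebra.ι k v))) (Fg g)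
          (psi k V x) +
        TensorProduct.map (Fg g) ((Fg g).comp (LinearMap.mulLeft k (TensorAlgebra.ι k v)))
          (psi k V x) := by
      rw [map_mul, psi_ι]
      generalize psi k V x = d
      induction d with
      | zero => simp
      | add x y hx hy => simp only [mul_add, map_add, hx, hy]; abel
      | tmul x y => simp [add_mul]
    rw [e0, e1, hl, LinearMap.comp_apply, LinearMap.add_apply]
    congr 1
    · change A (TensorProduct.map LinearMap.id (TensorProduct.map (Fg g) (Fg g))
        (TensorProduct.map LinearMap.id (psi k V).toLinearMap (psi k V x))) = _
      rw [← psi_coassoc]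
      have e2 : ∀ d, A (TensorProduct.map LinearMap.id (TensorProduct.map (Fg g) (Fg g))
          (TensorProduct.assoc k _ _ _ d)) = TensorProduct.map ((mgv g v).comp
            (TensorProduct.map LinearMap.id (Fg g))) (Fg g) d := by
        intro d
        induction d with
        | zero => simp
        | add x y hx hy => simp only [map_add, hx, hy]
        | tmul d y =>
          induction d with
          | zero => simp
          | add x y hx hy => simp only [TensorProduct.add_tmul, map_add, hx, hy]
          | tmul a b => simp [A]
      rw [e2, ← LinearMap.comp_apply, ← TensorProduct.map_comp, LinearMap.comp_id]
    · change B (TensorProduct.map LinearMap.id (TensorProduct.map (Fg g) (Fg g))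
        (TensorProduct.map LinearMap.id (psi k V).toLinearMap (psi k V x))) = _
      have e2 : ∀ d, B (TensorProduct.map LinearMap.id (TensorProduct.map (Fg g) (Fg g)) d) =
          TensorProduct.map (Fg g) ((mgv g v).comp (TensorProduct.map LinearMap.id (Fg g)))
            (TensorProduct.leftComm k _ _ _ d) := by
        intro d
        induction d with
        | zero => simp
        | add x y hx hy => simp only [map_add, hx, hy]
        | tmul y d =>
          induction d with
          | zero => simp
          | add x y hx hy => simp only [TensorProduct.tmul_add, map_add, hx, hy]
          | tmul a b => simp [B]
      rw [e2, psi_leftComm, ← LinearMap.comp_apply, ← TensorProduct.map_comp, LinearMap.comp_id]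

theorem Fg_local_step {g g' : TensorAlgebra k V →ₗ[k] TensorAlgebra k V} (n : ℕ)
    (hg : ∀ x ∈ Fil k V n, g x = g' x) (hF : ∀ x ∈ Fil k V n, Fg g x = Fg g' x) :
    ∀ x ∈ Fil k V (n + 1), Fg g x - g x = Fg g' x - g' x := by
  change Fil k V (n + 1) ≤ LinearMap.eqLocus (Fg g - g) (Fg g' - g')
  refine Fil_succ_le ?_ ?_
  · intro x hx
    change Fg g x - g x = Fg g' x - g' x
    rw [hg x hx, hF x hx]
  intro v x hx
  change Fg g _ - g _ = Fg g' _ - g' _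
  cases n with
  | zero =>
    obtain ⟨c, rfl⟩ := Fil_zero_mem hx
    have h1 : ∀ g : TensorAlgebra k V →ₗ[k] TensorAlgebra k V,
        Fg g (TensorAlgebra.ι k v * 1) = g (TensorAlgebra.ι k v * 1) := by
      intro g
      rw [Fg_ι]
      simp [Algebra.TensorProduct.one_def, Fg_one]
    rw [mul_smul_comm]
    simp only [map_smul, h1, sub_self]
  | succ n =>
    obtain ⟨w, hw, e⟩ := psi_Fil_succ n hx
    rw [Fg_ι, Fg_ι, e]
    have e1 : mgv g v (TensorProduct.map LinearMap.id (Fg g) w) =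
        mgv g' v (TensorProduct.map LinearMap.id (Fg g') w) := by
      refine tens_eqOn (f := (mgv g v).comp (TensorProduct.map LinearMap.id (Fg g)))
        (g := (mgv g' v).comp (TensorProduct.map LinearMap.id (Fg g'))) ?_ hw
      intro a ha b hb
      simp [hF b (Fil_le_succ n hb), hg _ (ι_mul_mem_Fil v ha)]
    simp only [map_add, e1, TensorProduct.map_tmul, mgv_tmul, LinearMap.id_apply, Fg_one, mul_one,
      hF x hx, hg _ (ι_mem_Fil n v)]
    abel

theorem Fg_local {g g' : TensorAlgebra k V →ₗ[k] TensorAlgebra k V} (n : ℕ)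
    (hg : ∀ x ∈ Fil k V n, g x = g' x) : ∀ x ∈ Fil k V n, Fg g x = Fg g' x := by
  induction n with
  | zero =>
    intro x hx
    obtain ⟨c, rfl⟩ := Fil_zero_mem hx
    simp [Fg_one]
  | succ n ih =>
    intro x hx
    have hg' : ∀ x ∈ Fil k V n, g x = g' x := fun x hx => hg x (Fil_le_succ n hx)
    have := Fg_local_step n hg' (ih hg') x hx
    rwa [hg x hx, sub_left_inj] at this

end Fmaps

section Limit
variable {k : Type} [Field k] {V W : Type} [AddCommGroup V] [Module k V]
  [AddCommGroup W] [Module k W]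

theorem Tmap_Fil (f : V →ₗ[k] W) (n : ℕ) : ∀ x ∈ Fil k V n, Tmap k f x ∈ Fil k W n := by
  induction n with
  | zero =>
    intro x hx
    obtain ⟨c, rfl⟩ := Fil_zero_mem hx
    rw [map_smul, map_one]
    exact Submodule.smul_mem _ _ (one_mem_Fil 0)
  | succ n ih =>
    change Fil k V (n + 1) ≤ (Fil k W (n + 1)).comap (Tmap k f).toLinearMap
    refine Fil_succ_le (fun x hx => Fil_le_succ n (ih x hx)) ?_
    intro v x hx
    change Tmap k f _ ∈ Fil k W (n + 1)
    rw [map_mul, Tmap_ι]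
    exact ι_mul_mem_Fil _ (ih x hx)

theorem split_of (φ : TensorAlgebra k V →ₗ[k] TensorAlgebra k V) {Y : Submodule k (TensorAlgebra k V)}
    {n : ℕ} (hY : ∀ a ∈ Fil k V n, φ a ∈ Y) (h1 : φ 1 = 1) {b : TensorAlgebra k V} (hb : φ b = b)
    (hψ : TensorProduct.map φ φ (psi k V b) = psi k V b) (hbn : b ∈ Fil k V (n + 1)) :
    ∃ w ∈ tens Y Y, psi k V b = b ⊗ₜ[k] 1 + 1 ⊗ₜ[k] b + w := by
  obtain ⟨w, hw, e⟩ := psi_Fil_succ n hbn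
  refine ⟨TensorProduct.map φ φ w, ?_, ?_⟩
  · refine tens_maps ?_ hw
    intro a ha b hb
    exact tmul_mem_tens (hY a ha) (hY b hb)
  · rw [← hψ, e]
    simp [h1, hb]

theorem eps_prim {x : TensorAlgebra k V} (h : psi k V x = x ⊗ₜ[k] 1 + 1 ⊗ₜ[k] x) :
    eps k V x = 0 := by
  have h1 := eps_psi x
  rw [h] at h1
  simp only [map_add, TensorProduct.map_tmul, TensorProduct.lid_tmul, LinearMap.id_apply, eps_one,
    one_smul, add_eq_right] at h1
  have h2 := congrArg (eps k V) h1
  simpa [eps_one] using h2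

/-- the sequence of primitive-valued maps -/
noncomputable def gseq (r : TensorAlgebra k V →ₗ[k] TensorAlgebra k V) :
    ℕ → (TensorAlgebra k V →ₗ[k] TensorAlgebra k V)
  | 0 => 0
  | n + 1 => (LinearMap.id - Fg (gseq r n) + gseq r n).comp (r.comp (trunc k V (n + 1)))

theorem gseq_succ_apply (r : TensorAlgebra k V →ₗ[k] TensorAlgebra k V) (n : ℕ) (x) :
    gseq r (n + 1) x = r (trunc k V (n + 1) x) - Fg (gseq r n) (r (trunc k V (n + 1) x)) +
      gseq r n (r (trunc k V (n + 1) x)) := rfl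

theorem gseq_nat {r : TensorAlgebra k V →ₗ[k] TensorAlgebra k V}
    {r' : TensorAlgebra k W →ₗ[k] TensorAlgebra k W} (f : V →ₗ[k] W)
    (hr : ∀ x, r' (Tmap k f x) = Tmap k f (r x)) (n : ℕ) :
    ∀ x, gseq r' n (Tmap k f x) = Tmap k f (gseq r n x) := by
  induction n with
  | zero => intro x; simp [gseq]
  | succ n ih =>
    intro x
    simp only [gseq_succ_apply, trunc_Tmap, hr, ih, Fg_nat _ f ih, map_add, map_sub]

/-- the data of a filtered linear retraction on a sub-coalgebra-algebra -/
structure RetData (A : Subalgebra k (TensorAlgebra k V))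
    (r : TensorAlgebra k V →ₗ[k] TensorAlgebra k V) : Prop where
  mem : ∀ x, r x ∈ A
  fix : ∀ x ∈ A, r x = x
  fil : ∀ n, ∀ x ∈ Fil k V n, r x ∈ Fil k V n
  cop : ∀ x ∈ A, psi k V x ∈ tens (Subalgebra.toSubmodule A) (Subalgebra.toSubmodule A)

variable {A : Subalgebra k (TensorAlgebra k V)} {r : TensorAlgebra k V →ₗ[k] TensorAlgebra k V}

theorem RetData.map_psi (h : RetData A r) {x} (hx : x ∈ A) :
    TensorProduct.map r r (psi k V x) = psi k V x := by
  refine tens_eqOn (g := LinearMap.id) ?_ (h.cop x hx)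
  intro a ha b hb
  rw [TensorProduct.map_tmul, h.fix a ha, h.fix b hb]
  rfl

theorem RetData.split (h : RetData A r) {n : ℕ} {x} (hx : x ∈ A) (hn : x ∈ Fil k V (n + 1)) :
    ∃ w ∈ tens (Subalgebra.toSubmodule A ⊓ Fil k V n) (Subalgebra.toSubmodule A ⊓ Fil k V n),
      psi k V x = x ⊗ₜ[k] 1 + 1 ⊗ₜ[k] x + w :=
  split_of r (Y := Subalgebra.toSubmodule A ⊓ Fil k V n)
    (fun a ha => Submodule.mem_inf.2 ⟨h.mem a, h.fil n a ha⟩) (h.fix 1 A.one_mem) (h.fix x hx)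
    (h.map_psi hx) hn

theorem RetData.gseq_spec (h : RetData A r) (n : ℕ) :
    (∀ x, gseq r n x ∈ A) ∧
    (∀ x, psi k V (gseq r n x) = gseq r n x ⊗ₜ[k] 1 + 1 ⊗ₜ[k] gseq r n x) ∧
    (∀ x ∈ A, x ∈ Fil k V n → Fg (gseq r n) x = x) ∧
    (∀ x ∈ Fil k V n, gseq r n (r x) = gseq r n x) := by
  induction n with
  | zero =>
    refine ⟨fun x => A.zero_mem, fun x => by simp [gseq], ?_, fun x _ => rfl⟩
    intro x _ hx
    obtain ⟨c, rfl⟩ := Fil_zero_mem hx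
    rw [map_smul, Fg_one]
  | succ n ih =>
    obtain ⟨i1, i2, i3, i4⟩ := ih
    have hco := Fg_coalg (gseq r n) i2
    have hloc : ∀ x ∈ Fil k V n, gseq r (n + 1) x = gseq r n x := by
      intro x hx
      rw [gseq_succ_apply, trunc_eq_self _ x (Fil_le_succ n hx), i4 x hx,
        i3 _ (h.mem x) (h.fil n x hx), sub_self, zero_add]
    refine ⟨?_, ?_, ?_, ?_⟩
    · intro x
      rw [gseq_succ_apply]
      exact A.add_mem (A.sub_mem (h.mem _) (Fg_range _ i1 _)) (i1 _)
    · intro x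
      rw [gseq_succ_apply]
      have hb := h.mem (trunc k V (n + 1) x)
      have hbn := h.fil (n + 1) _ (trunc_mem (n + 1) x)
      revert hb hbn
      generalize r (trunc k V (n + 1) x) = b
      intro hb hbn
      obtain ⟨w, hw, e⟩ := h.split hb hbn
      have hww : TensorProduct.map (Fg (gseq r n)) (Fg (gseq r n)) w = w := by
        refine tens_eqOn (g := LinearMap.id) ?_ hw
        intro a ha b hb
        rw [TensorProduct.map_tmul, i3 a ha.1 ha.2, i3 b hb.1 hb.2]
        rfl
      rw [map_add, map_sub, hco, e, i2]
      simp only [map_add, TensorProduct.map_tmul, Fg_one, hww, TensorProduct.add_tmul,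
        TensorProduct.tmul_add, TensorProduct.sub_tmul, TensorProduct.tmul_sub]
      abel
    · intro x hx hn
      have h1 := Fg_local_step n hloc (Fg_local n hloc) x hn
      rw [gseq_succ_apply, trunc_eq_self _ x hn, h.fix x hx] at h1
      have h2 : Fg (gseq r (n + 1)) x - x = 0 := by
        have : Fg (gseq r (n + 1)) x - x =
          (Fg (gseq r (n + 1)) x - (x - Fg (gseq r n) x + gseq r n x)) -
            (Fg (gseq r n) x - gseq r n x) := by abel
        rw [this, h1, sub_self]
      exact sub_eq_zero.1 h2
    · intro x hx
      rw [gseq_succ_apply, gseq_succ_apply, trunc_eq_self _ x hx,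
        trunc_eq_self _ _ (h.fil _ x hx), h.fix _ (h.mem x)]

theorem RetData.gseq_loc (h : RetData A r) (n : ℕ) :
    ∀ x ∈ Fil k V n, gseq r (n + 1) x = gseq r n x := by
  obtain ⟨i1, i2, i3, i4⟩ := h.gseq_spec n
  intro x hx
  rw [gseq_succ_apply, trunc_eq_self _ x (Fil_le_succ n hx), i4 x hx,
    i3 _ (h.mem x) (h.fil n x hx), sub_self, zero_add]

theorem RetData.Fg_stable (h : RetData A r) {n m : ℕ} (hnm : n ≤ m) :
    ∀ x ∈ Fil k V n, Fg (gseq r m) x = Fg (gseq r n) x := by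
  induction m, hnm using Nat.le_induction with
  | base => intro x _; rfl
  | succ m hm ih =>
    intro x hx
    rw [Fg_local m (h.gseq_loc m) x (Fil_mono hm hx), ih x hx]

theorem RetData.exists_rho (h : RetData A r) :
    ∃ ρ : TensorAlgebra k V →ₗ[k] TensorAlgebra k V,
      ∀ n, ∀ x ∈ Fil k V n, ρ x = Fg (gseq r n) x := by
  choose N hN using (Fil_exhaust : ∀ x : TensorAlgebra k V, _)
  have key : ∀ n x, x ∈ Fil k V n → Fg (gseq r (N x)) x = Fg (gseq r n) x := by
    intro n x hx
    rcases le_total n (N x) with hl | hl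
    · exact h.Fg_stable hl x hx
    · exact (h.Fg_stable hl x (hN x)).symm
  refine ⟨{ toFun := fun x => Fg (gseq r (N x)) x, map_add' := ?_, map_smul' := ?_ }, ?_⟩
  · intro x y
    have hx := Fil_mono (le_max_left (N x) (N y)) (hN x)
    have hy := Fil_mono (le_max_right (N x) (N y)) (hN y)
    rw [key _ _ (Submodule.add_mem _ hx hy), key _ x hx, key _ y hy, map_add]
  · intro c x
    rw [key _ _ (Submodule.smul_mem _ c (hN x)), map_smul, RingHom.id_apply]
  · intro n x hx
    exact key n x hx

open Classical in
/-- the limit retraction -/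
noncomputable def rho (r : TensorAlgebra k V →ₗ[k] TensorAlgebra k V) :
    TensorAlgebra k V →ₗ[k] TensorAlgebra k V :=
  if h : ∃ ρ : TensorAlgebra k V →ₗ[k] TensorAlgebra k V,
      ∀ n, ∀ x ∈ Fil k V n, ρ x = Fg (gseq r n) x then h.choose else 0

theorem RetData.rho_eq (h : RetData A r) {n : ℕ} {x} (hx : x ∈ Fil k V n) :
    rho r x = Fg (gseq r n) x := by
  rw [rho, dif_pos h.exists_rho]
  exact h.exists_rho.choose_spec n x hx

theorem RetData.rho_mem (h : RetData A r) (x) : rho r x ∈ A := by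
  obtain ⟨n, hn⟩ := Fil_exhaust x
  rw [h.rho_eq hn]
  exact Fg_range _ (h.gseq_spec n).1 x

theorem RetData.rho_fix (h : RetData A r) {x} (hx : x ∈ A) : rho r x = x := by
  obtain ⟨n, hn⟩ := Fil_exhaust x
  rw [h.rho_eq hn]
  exact (h.gseq_spec n).2.2.1 x hx hn

theorem RetData.rho_coalg (h : RetData A r) (x) :
    psi k V (rho r x) = TensorProduct.map (rho r) (rho r) (psi k V x) := by
  obtain ⟨n, hn⟩ := Fil_exhaust x
  rw [h.rho_eq hn, Fg_coalg _ (h.gseq_spec n).2.1]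
  refine tens_eqOn ?_ (psi_Fil n hn)
  intro a ha b hb
  rw [TensorProduct.map_tmul, TensorProduct.map_tmul, h.rho_eq ha, h.rho_eq hb]

theorem RetData.rho_eps (h : RetData A r) (x) : eps k V (rho r x) = eps k V x := by
  obtain ⟨n, hn⟩ := Fil_exhaust x
  rw [h.rho_eq hn]
  exact Fg_eps _ (fun y => eps_prim ((h.gseq_spec n).2.1 y)) x

theorem RetData.rho_nat (h : RetData A r) {A' : Subalgebra k (TensorAlgebra k W)}
    {r' : TensorAlgebra k W →ₗ[k] TensorAlgebra k W} (h' : RetData A' r') (f : V →ₗ[k] W)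
    (hr : ∀ x, r' (Tmap k f x) = Tmap k f (r x)) (x) :
    rho r' (Tmap k f x) = Tmap k f (rho r x) := by
  obtain ⟨n, hn⟩ := Fil_exhaust x
  rw [h.rho_eq hn, h'.rho_eq (Tmap_Fil f n x hn)]
  exact Fg_nat _ f (gseq_nat f hr n) x

end Limit

section Conv
variable {k : Type} [Field k] {V W : Type} [AddCommGroup V] [Module k V]
  [AddCommGroup W] [Module k W]

/-- the antipode -/
noncomputable def Sa (k V : Type) [Field k] [AddCommGroup V] [Module k V] :
    TensorAlgebra k V →ₗ[k] TensorAlgebra k V :=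
  (MulOpposite.opLinearEquiv k).symm.toLinearMap.comp
    (TensorAlgebra.lift k ((MulOpposite.opLinearEquiv k).toLinearMap.comp
      (-(TensorAlgebra.ι k : V →ₗ[k] TensorAlgebra k V)))).toLinearMap

theorem Sa_one : Sa k V 1 = 1 := by simp [Sa]

theorem Sa_ι (v : V) (x : TensorAlgebra k V) :
    Sa k V (TensorAlgebra.ι k v * x) = -(Sa k V x * TensorAlgebra.ι k v) := by
  simp [Sa]

theorem psi_ι_mul (v : V) (x : TensorAlgebra k V) :
    psi k V (TensorAlgebra.ι k v * x) =
      TensorProduct.map (LinearMap.mulLeft k (TensorAlgebra.ι k v)) LinearMap.id (psi k V x) +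
      TensorProduct.map LinearMap.id (LinearMap.mulLeft k (TensorAlgebra.ι k v)) (psi k V x) := by
  rw [map_mul, psi_ι]
  generalize psi k V x = d
  induction d with
  | zero => simp
  | add x y hx hy => simp only [mul_add, map_add, hx, hy]; abel
  | tmul x y => simp [add_mul]

/-- convolution -/
noncomputable def conv (f g : TensorAlgebra k V →ₗ[k] TensorAlgebra k V) :
    TensorAlgebra k V →ₗ[k] TensorAlgebra k V :=
  (LinearMap.mul' k _).comp ((TensorProduct.map f g).comp (psi k V).toLinearMap)

theorem conv_apply (f g : TensorAlgebra k V →ₗ[k] TensorAlgebra k V) (x) :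
    conv f g x = LinearMap.mul' k _ (TensorProduct.map f g (psi k V x)) := rfl

theorem conv_id_Sa (x : TensorAlgebra k V) :
    conv LinearMap.id (Sa k V) x = eps k V x • 1 := by
  induction x using tleft_ind with
  | h1 => simp [conv_apply, Algebra.TensorProduct.one_def, Sa_one, eps_one]
  | hadd x y hx hy => simp only [map_add, hx, hy, add_smul]
  | hsmul c x hx => simp only [map_smul, hx, smul_assoc]
  | hmul v x hx =>
    rw [eps_mul, eps_ι, zero_mul, zero_smul, conv_apply, psi_ι_mul]
    rw [conv_apply] at hx
    have key : ∀ d, LinearMap.mul' k _ (TensorProduct.map LinearMap.id (Sa k V)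
        (TensorProduct.map (LinearMap.mulLeft k (TensorAlgebra.ι k v)) LinearMap.id d +
      TensorProduct.map LinearMap.id (LinearMap.mulLeft k (TensorAlgebra.ι k v)) d)) =
        TensorAlgebra.ι k v * LinearMap.mul' k _ (TensorProduct.map LinearMap.id (Sa k V) d) -
        LinearMap.mul' k _ (TensorProduct.map LinearMap.id (Sa k V) d) * TensorAlgebra.ι k v := by
      intro d
      induction d with
      | zero => simp
      | add x y hx hy =>
        simp only [map_add, mul_add, add_mul] at hx hy ⊢
        have e := congrArg₂ HAdd.hAdd hx hy
        refine Eq.trans ?_ (e.trans ?_) <;> abel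
      | tmul x y => simp [Sa_ι, mul_assoc, sub_eq_add_neg]
    rw [key, hx]
    simp

theorem Sa_psi (x : TensorAlgebra k V) :
    psi k V (Sa k V x) = TensorProduct.map (Sa k V) (Sa k V) (psi k V x) := by
  induction x using tleft_ind with
  | h1 => simp [Sa_one, Algebra.TensorProduct.one_def]
  | hadd x y hx hy => simp only [map_add, hx, hy]
  | hsmul c x hx => simp only [map_smul, hx]
  | hmul v x hx =>
    rw [Sa_ι, map_neg, map_mul, hx, psi_ι_mul, psi_ι]
    generalize psi k V x = d
    induction d with
    | zero => simp
    | add x y hx hy =>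
      simp only [map_add, add_mul, neg_add] at hx hy ⊢
      rw [hx, hy]
      abel
    | tmul x y =>
      simp [Sa_ι, mul_add, TensorProduct.neg_tmul, TensorProduct.tmul_neg]
      abel

theorem Sa_eps (x : TensorAlgebra k V) : eps k V (Sa k V x) = eps k V x := by
  induction x using tleft_ind with
  | h1 => rw [Sa_one]
  | hadd x y hx hy => simp only [map_add, hx, hy]
  | hsmul c x hx => simp only [map_smul, hx]
  | hmul v x hx => simp [Sa_ι, eps_mul, eps_ι]

theorem Sa_nat (f : V →ₗ[k] W) (x : TensorAlgebra k V) :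
    Sa k W (Tmap k f x) = Tmap k f (Sa k V x) := by
  induction x using tleft_ind with
  | h1 => simp [Sa_one]
  | hadd x y hx hy => simp only [map_add, hx, hy]
  | hsmul c x hx => simp only [map_smul, hx]
  | hmul v x hx => simp [Sa_ι, Tmap_ι, hx]

theorem conv_nat {f g : TensorAlgebra k V →ₗ[k] TensorAlgebra k V}
    {f' g' : TensorAlgebra k W →ₗ[k] TensorAlgebra k W} (t : V →ₗ[k] W)
    (hf : ∀ x, f' (Tmap k t x) = Tmap k t (f x)) (hg : ∀ x, g' (Tmap k t x) = Tmap k t (g x)) (x) :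
    conv f' g' (Tmap k t x) = Tmap k t (conv f g x) := by
  rw [conv_apply, conv_apply, psi_Tmap]
  generalize psi k V x = d
  induction d with
  | zero => simp
  | add x y hx hy => simp only [map_add, hx, hy]
  | tmul x y => simp [hf, hg]

/-- coalgebra structure on `T ⊗ T` -/
noncomputable def delta (k V : Type) [Field k] [AddCommGroup V] [Module k V] :
    TensorAlgebra k V ⊗[k] TensorAlgebra k V →ₗ[k]
      (TensorAlgebra k V ⊗[k] TensorAlgebra k V) ⊗[k]
      (TensorAlgebra k V ⊗[k] TensorAlgebra k V) :=
  (TensorProduct.tensorTensorTensorComm k _ _ _ _).toLinearMap.comp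
    (TensorProduct.map (psi k V).toLinearMap (psi k V).toLinearMap)

theorem tens_ind2 {M : Type} [AddCommGroup M] [Module k M] {M₁ M₂ M₃ M₄ : Type}
    [AddCommGroup M₁] [Module k M₁] [AddCommGroup M₂] [Module k M₂]
    [AddCommGroup M₃] [Module k M₃] [AddCommGroup M₄] [Module k M₄]
    {f g : (M₁ ⊗[k] M₂) ⊗[k] (M₃ ⊗[k] M₄) →ₗ[k] M}
    (h : ∀ a b c d, f ((a ⊗ₜ b) ⊗ₜ (c ⊗ₜ d)) = g ((a ⊗ₜ b) ⊗ₜ (c ⊗ₜ d))) (z) : f z = g z := by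
  have : f = g := TensorProduct.ext_fourfold' h
  rw [this]

theorem psi_mul' (z : TensorAlgebra k V ⊗[k] TensorAlgebra k V) :
    psi k V (LinearMap.mul' k _ z) =
      TensorProduct.map (LinearMap.mul' k _) (LinearMap.mul' k _) (delta k V z) := by
  have key : ∀ d : (TensorAlgebra k V ⊗[k] TensorAlgebra k V) ⊗[k]
      (TensorAlgebra k V ⊗[k] TensorAlgebra k V), LinearMap.mul' k _ d =
      ((TensorProduct.map (LinearMap.mul' k _) (LinearMap.mul' k _)).comp
        (TensorProduct.tensorTensorTensorComm k _ _ _ _).toLinearMap) d := by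
    intro d
    refine tens_ind2 ?_ d
    intro a b c d
    simp
  induction z with
  | zero => simp
  | add x y hx hy => simp only [map_add, hx, hy]
  | tmul a b =>
    rw [LinearMap.mul'_apply, map_mul]
    exact key (psi k V a ⊗ₜ psi k V b)

theorem conv_coalg {f g : TensorAlgebra k V →ₗ[k] TensorAlgebra k V}
    (hf : ∀ x, psi k V (f x) = TensorProduct.map f f (psi k V x))
    (hg : ∀ x, psi k V (g x) = TensorProduct.map g g (psi k V x)) (x) :
    psi k V (conv f g x) = TensorProduct.map (conv f g) (conv f g) (psi k V x) := by
  rw [conv_apply, psi_mul']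
  have e1 : ∀ d, delta k V (TensorProduct.map f g d) =
      TensorProduct.map (TensorProduct.map f g) (TensorProduct.map f g) (delta k V d) := by
    intro d
    induction d with
    | zero => simp
    | add x y hx hy => simp only [map_add, hx, hy]
    | tmul a b =>
      simp only [delta, LinearMap.comp_apply, TensorProduct.map_tmul, AlgHom.toLinearMap_apply,
        hf, hg, LinearEquiv.coe_coe]
      rw [← TensorProduct.map_tmul]
      generalize psi k V a ⊗ₜ[k] psi k V b = z
      refine tens_ind2 (M := (TensorAlgebra k V ⊗[k] TensorAlgebra k V) ⊗[k]
          (TensorAlgebra k V ⊗[k] TensorAlgebra k V))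
        (f := (TensorProduct.tensorTensorTensorComm k _ _ _ _).toLinearMap.comp
        (TensorProduct.map (TensorProduct.map f f) (TensorProduct.map g g)))
        (g := (TensorProduct.map (TensorProduct.map f g) (TensorProduct.map f g)).comp
          (TensorProduct.tensorTensorTensorComm k _ _ _ _).toLinearMap) ?_ z
      intro a b c d
      simp
  rw [e1]
  have e2 : delta k V (psi k V x) =
      TensorProduct.map (psi k V).toLinearMap (psi k V).toLinearMap (psi k V x) := psi_middle x
  rw [e2]
  generalize psi k V x = d
  induction d with
  | zero => simp
  | add x y hx hy => simp only [map_add, hx, hy]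
  | tmul a b => simp [conv_apply]

theorem conv_eps {f g : TensorAlgebra k V →ₗ[k] TensorAlgebra k V}
    (hf : ∀ x, eps k V (f x) = eps k V x)
    (hg : ∀ x, eps k V (g x) = eps k V x) (x) : eps k V (conv f g x) = eps k V x := by
  rw [conv_apply]
  conv_rhs => rw [← eps_psi x]
  generalize psi k V x = d
  induction d with
  | zero => simp
  | add x y hx hy => simp only [map_add, hx, hy]
  | tmul a b => simp [eps_mul, hf, hg]

theorem eps_mul_of {f g : TensorAlgebra k V →ₗ[k] TensorAlgebra k V}
    {X Y : Submodule k (TensorAlgebra k V)} (hf : ∀ a ∈ X, f a = eps k V a • 1) {z}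
    (hz : z ∈ tens X Y) :
    LinearMap.mul' k _ (TensorProduct.map f g z) =
      g (TensorProduct.lid k _ (TensorProduct.map (eps k V) LinearMap.id z)) := by
  refine tens_eqOn (f := (LinearMap.mul' k _).comp (TensorProduct.map f g))
    (g := g.comp ((TensorProduct.lid k _).toLinearMap.comp
      (TensorProduct.map (eps k V) LinearMap.id))) ?_ hz
  intro a ha b hb
  simp [hf a ha]

/-- a coalgebra endomorphism preserving everything -/
structure CoEnd (φ : TensorAlgebra k V →ₗ[k] TensorAlgebra k V) : Prop where
  fil : ∀ n, ∀ x ∈ Fil k V n, φ x ∈ Fil k V n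
  coalg : ∀ x, psi k V (φ x) = TensorProduct.map φ φ (psi k V x)
  eps : ∀ x, eps k V (φ x) = eps k V x
  one : φ 1 = 1

theorem CoEnd.pow {φ : TensorAlgebra k V →ₗ[k] TensorAlgebra k V} (h : CoEnd φ) (n : ℕ) :
    CoEnd ((φ ^ n : Module.End k (TensorAlgebra k V)) :
      TensorAlgebra k V →ₗ[k] TensorAlgebra k V) := by
  induction n with
  | zero =>
    refine ⟨fun _ x hx => hx, fun x => ?_, fun x => rfl, rfl⟩
    have : (φ ^ 0 : Module.End k (TensorAlgebra k V)) = LinearMap.id := rfl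
    rw [this, TensorProduct.map_id]
    rfl
  | succ n ih =>
    rw [pow_succ']
    refine ⟨fun m x hx => h.fil m _ (ih.fil m x hx), fun x => ?_, fun x => ?_, ?_⟩
    · rw [Module.End.mul_apply, h.coalg, ih.coalg, Module.End.mul_eq_comp, TensorProduct.map_comp]
      rfl
    · rw [Module.End.mul_apply, h.eps, ih.eps]
    · rw [Module.End.mul_apply, ih.one, h.one]

/-- the complementary projection-like map -/
noncomputable def Phi (ρ : TensorAlgebra k V →ₗ[k] TensorAlgebra k V) :
    TensorAlgebra k V →ₗ[k] TensorAlgebra k V := conv ((Sa k V).comp ρ) LinearMap.id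

theorem conv_rho_Phi {ρ : TensorAlgebra k V →ₗ[k] TensorAlgebra k V} (h : CoEnd ρ) (x) :
    conv ρ (Phi ρ) x = x := by
  have e0 : ∀ y, conv ρ ((Sa k V).comp ρ) y = eps k V y • 1 := by
    intro y
    rw [← h.eps, ← conv_id_Sa, conv_apply, conv_apply, h.coalg]
    generalize psi k V y = d
    induction d with
    | zero => simp
    | add x y hx hy => simp only [map_add, hx, hy]
    | tmul a b => simp
  have e1 : ∀ d, LinearMap.mul' k _ (TensorProduct.map ρ ((LinearMap.mul' k _).comp
      (TensorProduct.map ((Sa k V).comp ρ) LinearMap.id)) (TensorProduct.assoc k _ _ _ d)) =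
      LinearMap.mul' k _ (TensorProduct.map ((LinearMap.mul' k _).comp
      (TensorProduct.map ρ ((Sa k V).comp ρ))) LinearMap.id d) := by
    intro d
    induction d with
    | zero => simp
    | add x y hx hy => simp only [map_add, hx, hy]
    | tmul d y =>
      induction d with
      | zero => simp
      | add x y hx hy => simp only [TensorProduct.add_tmul, map_add, hx, hy]
      | tmul a b => simp [mul_assoc]
  have e2 : Phi ρ = ((LinearMap.mul' k _).comp
      (TensorProduct.map ((Sa k V).comp ρ) LinearMap.id)).comp (psi k V).toLinearMap := rfl
  have e3 : TensorProduct.map ρ (Phi ρ) (psi k V x) = TensorProduct.map ρ ((LinearMap.mul' k _).comp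
      (TensorProduct.map ((Sa k V).comp ρ) LinearMap.id))
        (TensorProduct.map LinearMap.id (psi k V).toLinearMap (psi k V x)) := by
    rw [e2, ← LinearMap.comp_apply, ← TensorProduct.map_comp, LinearMap.comp_id]
  rw [conv_apply, e3, ← psi_coassoc, e1, ← LinearMap.comp_apply, ← LinearMap.comp_apply,
    LinearMap.comp_assoc, ← TensorProduct.map_comp, LinearMap.comp_apply, LinearMap.comp_id]
  have e4 : psi k V x ∈ tens (⊤ : Submodule k (TensorAlgebra k V))
    (⊤ : Submodule k (TensorAlgebra k V)) := by rw [tens_top_top]; trivial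
  change LinearMap.mul' k _ (TensorProduct.map (conv ρ ((Sa k V).comp ρ)) LinearMap.id
    (psi k V x)) = x
  rw [eps_mul_of (fun a _ => e0 a) e4, eps_psi]
  rfl

end Conv

section Compl
variable {k : Type} [Field k] {V : Type} [AddCommGroup V] [Module k V]

/-- the complement `C` -/
noncomputable def Cc (ρ : TensorAlgebra k V →ₗ[k] TensorAlgebra k V) :
    Submodule k (TensorAlgebra k V) := LinearMap.eqLocus (Phi ρ) LinearMap.id

theorem mem_Cc {ρ : TensorAlgebra k V →ₗ[k] TensorAlgebra k V} {x} :
    x ∈ Cc ρ ↔ Phi ρ x = x := Iff.rfl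

/-- iterates of `Phi` -/
noncomputable def PhiN (ρ : TensorAlgebra k V →ₗ[k] TensorAlgebra k V) (n : ℕ) :
    TensorAlgebra k V →ₗ[k] TensorAlgebra k V :=
  (Phi ρ ^ n : Module.End k (TensorAlgebra k V))

theorem PhiN_zero (ρ : TensorAlgebra k V →ₗ[k] TensorAlgebra k V) (x) : PhiN ρ 0 x = x := rfl

theorem PhiN_succ (ρ : TensorAlgebra k V →ₗ[k] TensorAlgebra k V) (n : ℕ) (x) :
    PhiN ρ (n + 1) x = Phi ρ (PhiN ρ n x) := by
  rw [PhiN, pow_succ']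
  rfl

variable {A : Subalgebra k (TensorAlgebra k V)} {ρ : TensorAlgebra k V →ₗ[k] TensorAlgebra k V}

theorem PhiN_co (h : RetData A ρ) (hρ : CoEnd ρ) (hΦ : CoEnd (Phi ρ))
    (n : ℕ) : CoEnd (PhiN ρ n) := hΦ.pow n

theorem lemN (h : RetData A ρ) (hρ : CoEnd ρ) (hΦ : CoEnd (Phi ρ))
    (n : ℕ) : ∀ x ∈ Fil k V n, ρ (PhiN ρ n x) = eps k V x • 1 := by
  induction n with
  | zero =>
    intro x hx
    obtain ⟨c, rfl⟩ := Fil_zero_mem hx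
    rw [PhiN_zero, map_smul, map_smul, eps_one, hρ.one, smul_eq_mul, mul_one]
  | succ n ih =>
    intro x hx
    have hn := PhiN_co h hρ hΦ n
    obtain ⟨w, hw, e⟩ := psi_Fil_succ n hx
    have e1 := conv_rho_Phi hρ (PhiN ρ n x)
    have e2 : TensorProduct.lid k _ (TensorProduct.map (eps k V) LinearMap.id w) =
        -(eps k V x • 1) := by
      have h1 := eps_psi x
      rw [e] at h1
      simp only [map_add, TensorProduct.map_tmul, TensorProduct.lid_tmul, LinearMap.id_apply,
        eps_one, one_smul] at h1
      have h2 : eps k V x • (1 : TensorAlgebra k V) +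
        TensorProduct.lid k _ (TensorProduct.map (eps k V) LinearMap.id w) = 0 := by
        have h3 := sub_eq_zero.2 h1
        rw [← h3]
        abel
      exact (neg_eq_of_add_eq_zero_right h2).symm
    have e3 : LinearMap.mul' k _ (TensorProduct.map ρ (Phi ρ)
        (TensorProduct.map (PhiN ρ n) (PhiN ρ n) w)) = -(eps k V x • 1) := by
      have h1 := eps_mul_of (f := ρ.comp (PhiN ρ n)) (g := (Phi ρ).comp (PhiN ρ n)) ih hw
      rw [TensorProduct.map_comp] at h1
      rw [e2, LinearMap.comp_apply, LinearMap.comp_apply, map_neg, map_smul, hn.one, map_neg,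
        map_smul, hΦ.one] at h1
      exact h1
    rw [conv_apply, hn.coalg, e] at e1
    simp only [map_add, TensorProduct.map_tmul, hn.one, hρ.one, hΦ.one, LinearMap.mul'_apply,
      mul_one, one_mul, e3] at e1
    have e4 := congrArg ρ e1
    simp only [map_add, map_neg, map_smul, hρ.one, h.fix _ (h.mem _)] at e4
    rw [PhiN_succ]
    have e5 := sub_eq_zero.2 e4
    rw [← sub_eq_zero, ← e5]
    abel

theorem Phi_fixed (h : RetData A ρ) (hρ : CoEnd ρ) (hΦ : CoEnd (Phi ρ))
    (n : ℕ) {x} (hx : x ∈ Fil k V n) : PhiN ρ n x ∈ Cc ρ := by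
  rw [mem_Cc]
  have hn := PhiN_co h hρ hΦ n
  have e1 := conv_rho_Phi hρ (PhiN ρ n x)
  have h1 := eps_mul_of (f := ρ.comp (PhiN ρ n)) (g := (Phi ρ).comp (PhiN ρ n))
    (lemN h hρ hΦ n) (psi_Fil n hx)
  rw [TensorProduct.map_comp, eps_psi] at h1
  rw [conv_apply, hn.coalg] at e1
  exact h1.symm.trans e1

theorem PhiN_fix (n : ℕ) {x} (hx : x ∈ Cc ρ) : PhiN ρ n x = x := by
  induction n with
  | zero => rfl
  | succ n ih => rw [PhiN_succ, ih, mem_Cc.1 hx]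

theorem rho_C (h : RetData A ρ) (hρ : CoEnd ρ) (hΦ : CoEnd (Phi ρ))
    {x} (hx : x ∈ Cc ρ) : ρ x = eps k V x • 1 := by
  obtain ⟨n, hn⟩ := Fil_exhaust x
  rw [← lemN h hρ hΦ n x hn, PhiN_fix n hx]

theorem C_cop (h : RetData A ρ) (hρ : CoEnd ρ) (hΦ : CoEnd (Phi ρ))
    {x} (hx : x ∈ Cc ρ) : psi k V x ∈ tens (Cc ρ) (Cc ρ) := by
  obtain ⟨n, hn⟩ := Fil_exhaust x
  rw [← PhiN_fix n hx, (PhiN_co h hρ hΦ n).coalg]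
  refine tens_maps ?_ (psi_Fil n hn)
  intro a ha b hb
  exact tmul_mem_tens (Phi_fixed h hρ hΦ n ha) (Phi_fixed h hρ hΦ n hb)

theorem C_split (h : RetData A ρ) (hρ : CoEnd ρ) (hΦ : CoEnd (Phi ρ))
    {n : ℕ} {x} (hx : x ∈ Cc ρ) (hn : x ∈ Fil k V (n + 1)) :
    ∃ w ∈ tens (Cc ρ ⊓ Fil k V n) (Cc ρ ⊓ Fil k V n),
      psi k V x = x ⊗ₜ[k] 1 + 1 ⊗ₜ[k] x + w := by
  have hc := PhiN_co h hρ hΦ n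
  refine split_of (PhiN ρ n) (Y := Cc ρ ⊓ Fil k V n)
    (fun a ha => Submodule.mem_inf.2 ⟨Phi_fixed h hρ hΦ n ha, hc.fil n a ha⟩) hc.one
    (PhiN_fix n hx) ?_ hn
  rw [← hc.coalg, PhiN_fix n hx]

theorem surj_mul (h : RetData A ρ) (hρ : CoEnd ρ) (hΦ : CoEnd (Phi ρ))
    (n : ℕ) :
    Fil k V n ≤ (tens (Subalgebra.toSubmodule A) (Cc ρ)).map (LinearMap.mul' k _) := by
  have hl : ∀ a ∈ A, ∀ y ∈ (tens (Subalgebra.toSubmodule A) (Cc ρ)).map (LinearMap.mul' k _),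
      a * y ∈ (tens (Subalgebra.toSubmodule A) (Cc ρ)).map (LinearMap.mul' k _) := by
    rintro a ha _ ⟨z, hz, rfl⟩
    refine ⟨TensorProduct.map (LinearMap.mulLeft k a) LinearMap.id z, ?_, ?_⟩
    · refine tens_maps ?_ hz
      intro b hb c hc
      exact tmul_mem_tens (A.mul_mem ha hb) hc
    · generalize z = d
      induction d with
      | zero => simp
      | add x y hx hy => simp only [map_add, mul_add, hx, hy]
      | tmul x y => simp [mul_assoc]
  have hC : Cc ρ ≤ (tens (Subalgebra.toSubmodule A) (Cc ρ)).map (LinearMap.mul' k _) := by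
    intro c hc
    exact ⟨1 ⊗ₜ c, tmul_mem_tens A.one_mem hc, by simp⟩
  have h1 : (1 : TensorAlgebra k V) ∈ Cc ρ := hΦ.one
  induction n with
  | zero =>
    intro x hx
    obtain ⟨c, rfl⟩ := Fil_zero_mem hx
    exact Submodule.smul_mem _ _ (hC h1)
  | succ n ih =>
    have key : ∀ y ∈ Fil k V (n + 1), y - Phi ρ y ∈
        (tens (Subalgebra.toSubmodule A) (Cc ρ)).map (LinearMap.mul' k _) := by
      intro y hy
      obtain ⟨w, hw, e⟩ := psi_Fil_succ n hy
      have e1 := conv_rho_Phi hρ y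
      rw [conv_apply, e] at e1
      simp only [map_add, TensorProduct.map_tmul, hρ.one, hΦ.one, LinearMap.mul'_apply,
        mul_one, one_mul] at e1
      have e2 : y - Phi ρ y = ρ y + LinearMap.mul' k _ (TensorProduct.map ρ (Phi ρ) w) := by
        conv_lhs => rw [← e1]
        rw [e1]
        rw [sub_eq_iff_eq_add]
        conv_lhs => rw [← e1]
        abel
      rw [e2]
      refine Submodule.add_mem _ ?_ ?_
      · have := hl _ (h.mem y) _ (hC h1)
        rwa [mul_one] at this
      · refine tens_maps (f := (LinearMap.mul' k _).comp (TensorProduct.map ρ (Phi ρ))) ?_ hw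
        intro a _ b hb
        exact hl _ (h.mem a) _ (ih (hΦ.fil n b hb))
    intro y hy
    have key2 : ∀ m, y - PhiN ρ m y ∈
        (tens (Subalgebra.toSubmodule A) (Cc ρ)).map (LinearMap.mul' k _) := by
      intro m
      induction m with
      | zero => rw [PhiN_zero, sub_self]; exact Submodule.zero_mem _
      | succ m ihm =>
        have := Submodule.add_mem _ ihm (key _ ((PhiN_co h hρ hΦ m).fil _ y hy))
        rwa [sub_add_sub_cancel, ← PhiN_succ] at this
    have := Submodule.add_mem _ (key2 (n + 1)) (hC (Phi_fixed h hρ hΦ (n + 1) hy))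
    rwa [sub_add_cancel] at this

end Compl

section Inj
variable {k : Type} [Field k] {V : Type} [AddCommGroup V] [Module k V]

/-- filtration on `A ⊗ C` -/
noncomputable def Nn (P Q : Submodule k (TensorAlgebra k V)) (n : ℕ) :
    Submodule k (TensorAlgebra k V ⊗[k] TensorAlgebra k V) :=
  Submodule.span k {z | ∃ i j, i + j ≤ n ∧ ∃ a ∈ P ⊓ Fil k V i, ∃ b ∈ Q ⊓ Fil k V j,
    z = a ⊗ₜ[k] b}

variable {P Q : Submodule k (TensorAlgebra k V)}

theorem tmul_mem_Nn {n : ℕ} (i j : ℕ) (hij : i + j ≤ n) {a b} (ha : a ∈ P ⊓ Fil k V i)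
    (hb : b ∈ Q ⊓ Fil k V j) : a ⊗ₜ[k] b ∈ Nn P Q n :=
  Submodule.subset_span ⟨i, j, hij, a, ha, b, hb, rfl⟩

theorem Nn_mono : Monotone (Nn P Q) := by
  intro n m hnm
  refine Submodule.span_mono ?_
  rintro z ⟨i, j, hij, r⟩
  exact ⟨i, j, hij.trans hnm, r⟩

theorem Nn_le_tens (n : ℕ) : Nn P Q n ≤ tens P Q := by
  refine Submodule.span_le.2 ?_
  rintro z ⟨i, j, hij, a, ha, b, hb, rfl⟩
  exact tmul_mem_tens ha.1 hb.1

theorem mem_Nn_of_tens {z} (hz : z ∈ tens P Q) : ∃ n, z ∈ Nn P Q n := by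
  rw [tens_eq_span] at hz
  induction hz using Submodule.span_induction with
  | mem z hz =>
    obtain ⟨a, ha, b, hb, rfl⟩ := hz
    obtain ⟨i, hi⟩ := Fil_exhaust a
    obtain ⟨j, hj⟩ := Fil_exhaust b
    exact ⟨i + j, tmul_mem_Nn i j le_rfl ⟨ha, hi⟩ ⟨hb, hj⟩⟩
  | zero => exact ⟨0, Submodule.zero_mem _⟩
  | add x y _ _ hx hy =>
    obtain ⟨n, hn⟩ := hx
    obtain ⟨m, hm⟩ := hy
    exact ⟨max n m, Submodule.add_mem _ (Nn_mono (le_max_left _ _) hn)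
      (Nn_mono (le_max_right _ _) hm)⟩
  | smul c x _ hx =>
    obtain ⟨n, hn⟩ := hx
    exact ⟨n, Submodule.smul_mem _ _ hn⟩

/-- a submodule with filtered reduced diagonal -/
structure SubCo (P : Submodule k (TensorAlgebra k V)) : Prop where
  one : 1 ∈ P
  split : ∀ (n : ℕ) (x), x ∈ P → x ∈ Fil k V (n + 1) →
    ∃ w ∈ tens (P ⊓ Fil k V n) (P ⊓ Fil k V n), psi k V x = x ⊗ₜ[k] 1 + 1 ⊗ₜ[k] x + w

theorem delta_split (hP : SubCo P) (hQ : SubCo Q) (n : ℕ) {z} (hz : z ∈ Nn P Q (n + 1)) :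
    ∃ w ∈ tens (Nn P Q n) (Nn P Q n),
      delta k V z = z ⊗ₜ[k] (1 ⊗ₜ[k] 1) + (1 ⊗ₜ[k] 1) ⊗ₜ[k] z + w := by
  suffices hs : delta k V z - z ⊗ₜ[k] (1 ⊗ₜ[k] 1) - (1 ⊗ₜ[k] 1) ⊗ₜ[k] z ∈
      tens (Nn P Q n) (Nn P Q n) from ⟨_, hs, by abel⟩
  let L : TensorAlgebra k V ⊗[k] TensorAlgebra k V →ₗ[k]
      (TensorAlgebra k V ⊗[k] TensorAlgebra k V) ⊗[k]
      (TensorAlgebra k V ⊗[k] TensorAlgebra k V) :=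
    { toFun := fun z => delta k V z - z ⊗ₜ[k] (1 ⊗ₜ[k] 1) - (1 ⊗ₜ[k] 1) ⊗ₜ[k] z
      map_add' := fun x y => by
        rw [map_add, TensorProduct.add_tmul, TensorProduct.tmul_add]; abel
      map_smul' := fun c x => by
        rw [map_smul, TensorProduct.tmul_smul, ← TensorProduct.smul_tmul', RingHom.id_apply,
          smul_sub, smul_sub] }
  have hL : ∀ z, L z = delta k V z - z ⊗ₜ[k] (1 ⊗ₜ[k] 1) - (1 ⊗ₜ[k] 1) ⊗ₜ[k] z := fun _ => rfl
  change L z ∈ _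
  revert z
  change Nn P Q (n + 1) ≤ (tens (Nn P Q n) (Nn P Q n)).comap L
  refine Submodule.span_le.2 ?_
  rintro z ⟨i, j, hij, a, ha, b, hb, rfl⟩
  have onP : ∀ i, (1 : TensorAlgebra k V) ∈ P ⊓ Fil k V i := fun i => ⟨hP.one, one_mem_Fil i⟩
  have onQ : ∀ i, (1 : TensorAlgebra k V) ∈ Q ⊓ Fil k V i := fun i => ⟨hQ.one, one_mem_Fil i⟩
  have hd : ∀ a b, delta k V (a ⊗ₜ b) =
    TensorProduct.tensorTensorTensorComm k (TensorAlgebra k V) (TensorAlgebra k V) (TensorAlgebra k V) (TensorAlgebra k V) (psi k V a ⊗ₜ psi k V b) := fun _ _ => rfl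
  have psi1 : psi k V 1 = 1 ⊗ₜ 1 := by rw [map_one, Algebra.TensorProduct.one_def]
  change L _ ∈ tens (Nn P Q n) (Nn P Q n)
  rw [hL, hd]
  -- helper memberships
  have m1 : ∀ (j : ℕ) (x y w), w ∈ tens (Q ⊓ Fil k V j) (Q ⊓ Fil k V j) →
      (∀ c ∈ Q ⊓ Fil k V j, x ⊗ₜ c ∈ Nn P Q n) → (∀ c ∈ Q ⊓ Fil k V j, y ⊗ₜ c ∈ Nn P Q n) →
      TensorProduct.tensorTensorTensorComm k (TensorAlgebra k V) (TensorAlgebra k V) (TensorAlgebra k V) (TensorAlgebra k V) ((x ⊗ₜ[k] y) ⊗ₜ[k] w) ∈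
        tens (Nn P Q n) (Nn P Q n) := by
    intro j x y w hw hx hy
    refine tens_maps (P := (TensorAlgebra k V ⊗[k] TensorAlgebra k V) ⊗[k] (TensorAlgebra k V ⊗[k] TensorAlgebra k V))
      (f := (TensorProduct.tensorTensorTensorComm k (TensorAlgebra k V) (TensorAlgebra k V)
        (TensorAlgebra k V) (TensorAlgebra k V)).toLinearMap.comp
      (TensorProduct.mk k (TensorAlgebra k V ⊗[k] TensorAlgebra k V) (TensorAlgebra k V ⊗[k] TensorAlgebra k V) (x ⊗ₜ[k] y))) ?_ hw
    intro c hc d hd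
    exact tmul_mem_tens (hx c hc) (hy d hd)
  have m2 : ∀ (j : ℕ) (x y w), w ∈ tens (P ⊓ Fil k V j) (P ⊓ Fil k V j) →
      (∀ c ∈ P ⊓ Fil k V j, c ⊗ₜ x ∈ Nn P Q n) → (∀ c ∈ P ⊓ Fil k V j, c ⊗ₜ y ∈ Nn P Q n) →
      TensorProduct.tensorTensorTensorComm k (TensorAlgebra k V) (TensorAlgebra k V) (TensorAlgebra k V) (TensorAlgebra k V) (w ⊗ₜ[k] (x ⊗ₜ[k] y)) ∈
        tens (Nn P Q n) (Nn P Q n) := by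
    intro j x y w hw hx hy
    refine tens_maps (P := (TensorAlgebra k V ⊗[k] TensorAlgebra k V) ⊗[k] (TensorAlgebra k V ⊗[k] TensorAlgebra k V))
      (f := (TensorProduct.tensorTensorTensorComm k (TensorAlgebra k V) (TensorAlgebra k V)
        (TensorAlgebra k V) (TensorAlgebra k V)).toLinearMap.comp
      ((TensorProduct.mk k (TensorAlgebra k V ⊗[k] TensorAlgebra k V) (TensorAlgebra k V ⊗[k] TensorAlgebra k V)).flip (x ⊗ₜ[k] y))) ?_ hw
    intro c hc d hd
    exact tmul_mem_tens (hx c hc) (hy d hd)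
  rcases i with _ | i
  · obtain ⟨c, rfl⟩ := Fil_zero_mem ha.2
    obtain ⟨w, hw, e⟩ := hQ.split n b hb.1 (Fil_mono (by omega) hb.2)
    have e2 : TensorProduct.tensorTensorTensorComm k (TensorAlgebra k V) (TensorAlgebra k V) (TensorAlgebra k V) (TensorAlgebra k V) (psi k V (c • 1) ⊗ₜ psi k V b) -
        ((c • 1) ⊗ₜ b) ⊗ₜ[k] (1 ⊗ₜ[k] 1) - (1 ⊗ₜ[k] 1) ⊗ₜ[k] ((c • 1) ⊗ₜ b) =
        c • TensorProduct.tensorTensorTensorComm k (TensorAlgebra k V) (TensorAlgebra k V) (TensorAlgebra k V) (TensorAlgebra k V) (((1 : TensorAlgebra k V) ⊗ₜ[k]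
          (1 : TensorAlgebra k V)) ⊗ₜ[k] w) := by
      rw [e, map_smul, psi1]
      simp only [TensorProduct.tmul_add, ← TensorProduct.smul_tmul', map_smul, map_add,
        TensorProduct.tensorTensorTensorComm_tmul, TensorProduct.tmul_smul, smul_add]
      abel
    rw [e2]
    refine Submodule.smul_mem _ _ (m1 n 1 1 w hw ?_ ?_) <;>
      exact fun c hc => tmul_mem_Nn 0 n (by omega) (onP 0) hc
  rcases j with _ | j
  · obtain ⟨c, rfl⟩ := Fil_zero_mem hb.2
    obtain ⟨w, hw, e⟩ := hP.split n a ha.1 (Fil_mono (by omega) ha.2)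
    have e2 : TensorProduct.tensorTensorTensorComm k (TensorAlgebra k V) (TensorAlgebra k V) (TensorAlgebra k V) (TensorAlgebra k V) (psi k V a ⊗ₜ psi k V (c • 1)) -
        (a ⊗ₜ (c • 1)) ⊗ₜ[k] (1 ⊗ₜ[k] 1) - (1 ⊗ₜ[k] 1) ⊗ₜ[k] (a ⊗ₜ (c • 1)) =
        c • TensorProduct.tensorTensorTensorComm k (TensorAlgebra k V) (TensorAlgebra k V) (TensorAlgebra k V) (TensorAlgebra k V) (w ⊗ₜ[k] ((1 : TensorAlgebra k V) ⊗ₜ[k]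
          (1 : TensorAlgebra k V))) := by
      rw [e, map_smul, psi1]
      simp only [TensorProduct.add_tmul, TensorProduct.tmul_smul, map_smul, map_add,
        TensorProduct.tensorTensorTensorComm_tmul, ← TensorProduct.smul_tmul', smul_add]
      abel
    rw [e2]
    refine Submodule.smul_mem _ _ (m2 n 1 1 w hw ?_ ?_) <;>
      exact fun c hc => tmul_mem_Nn n 0 (by omega) hc (onQ 0)
  obtain ⟨w, hw, e⟩ := hP.split i a ha.1 ha.2
  obtain ⟨u, hu, e'⟩ := hQ.split j b hb.1 hb.2
  have e2 : TensorProduct.tensorTensorTensorComm k (TensorAlgebra k V) (TensorAlgebra k V) (TensorAlgebra k V) (TensorAlgebra k V) (psi k V a ⊗ₜ psi k V b) -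
        (a ⊗ₜ b) ⊗ₜ[k] (1 ⊗ₜ[k] 1) - (1 ⊗ₜ[k] 1) ⊗ₜ[k] (a ⊗ₜ b) =
      (a ⊗ₜ 1) ⊗ₜ (1 ⊗ₜ b) + (1 ⊗ₜ b) ⊗ₜ (a ⊗ₜ 1) +
      TensorProduct.tensorTensorTensorComm k (TensorAlgebra k V) (TensorAlgebra k V) (TensorAlgebra k V) (TensorAlgebra k V) ((a ⊗ₜ[k] 1) ⊗ₜ[k] u) +
      TensorProduct.tensorTensorTensorComm k (TensorAlgebra k V) (TensorAlgebra k V) (TensorAlgebra k V) (TensorAlgebra k V) ((1 ⊗ₜ[k] a) ⊗ₜ[k] u) +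
      TensorProduct.tensorTensorTensorComm k (TensorAlgebra k V) (TensorAlgebra k V) (TensorAlgebra k V) (TensorAlgebra k V) (w ⊗ₜ[k] (b ⊗ₜ[k] 1)) +
      TensorProduct.tensorTensorTensorComm k (TensorAlgebra k V) (TensorAlgebra k V) (TensorAlgebra k V) (TensorAlgebra k V) (w ⊗ₜ[k] (1 ⊗ₜ[k] b)) +
      TensorProduct.tensorTensorTensorComm k (TensorAlgebra k V) (TensorAlgebra k V) (TensorAlgebra k V) (TensorAlgebra k V) (w ⊗ₜ[k] u) := by
    rw [e, e']
    simp only [TensorProduct.add_tmul, TensorProduct.tmul_add, map_add,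
        TensorProduct.tensorTensorTensorComm_tmul]
    abel
  rw [e2]
  refine Submodule.add_mem _ (Submodule.add_mem _ (Submodule.add_mem _ (Submodule.add_mem _
    (Submodule.add_mem _ (Submodule.add_mem _ ?_ ?_) ?_) ?_) ?_) ?_) ?_
  · exact tmul_mem_tens (tmul_mem_Nn (i + 1) 0 (by omega) ha (onQ 0))
      (tmul_mem_Nn 0 (j + 1) (by omega) (onP 0) hb)
  · exact tmul_mem_tens (tmul_mem_Nn 0 (j + 1) (by omega) (onP 0) hb)
      (tmul_mem_Nn (i + 1) 0 (by omega) ha (onQ 0))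
  · exact m1 j a 1 u hu (fun c hc => tmul_mem_Nn (i + 1) j (by omega) ha hc)
      (fun c hc => tmul_mem_Nn 0 j (by omega) (onP 0) hc)
  · exact m1 j 1 a u hu (fun c hc => tmul_mem_Nn 0 j (by omega) (onP 0) hc)
      (fun c hc => tmul_mem_Nn (i + 1) j (by omega) ha hc)
  · exact m2 i b 1 w hw (fun c hc => tmul_mem_Nn i (j + 1) (by omega) hc hb)
      (fun c hc => tmul_mem_Nn i 0 (by omega) hc (onQ 0))
  · exact m2 i 1 b w hw (fun c hc => tmul_mem_Nn i 0 (by omega) hc (onQ 0))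
      (fun c hc => tmul_mem_Nn i (j + 1) (by omega) hc hb)
  · refine tens_maps (P := (TensorAlgebra k V ⊗[k] TensorAlgebra k V) ⊗[k] (TensorAlgebra k V ⊗[k] TensorAlgebra k V))
      (f := (TensorProduct.tensorTensorTensorComm k (TensorAlgebra k V) (TensorAlgebra k V)
        (TensorAlgebra k V) (TensorAlgebra k V)).toLinearMap.comp
      ((TensorProduct.mk k (TensorAlgebra k V ⊗[k] TensorAlgebra k V) (TensorAlgebra k V ⊗[k] TensorAlgebra k V)).flip u)) ?_ hw
    intro x hx y hy
    exact m1 j x y u hu (fun c hc => tmul_mem_Nn i j (by omega) hx hc)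
      (fun c hc => tmul_mem_Nn i j (by omega) hy hc)

theorem tens_inj {M N : Type} [AddCommGroup M] [Module k M] [AddCommGroup N] [Module k N]
    {X : Submodule k M} {f : M →ₗ[k] N} (hf : ∀ a ∈ X, f a = 0 → a = 0) {z}
    (hz : z ∈ tens X X) (h0 : TensorProduct.map f f z = 0) : z = 0 := by
  rw [tens_eq_range] at hz
  obtain ⟨y, rfl⟩ := hz
  have hi : Function.Injective (f.comp X.subtype) := by
    rw [← LinearMap.ker_eq_bot, LinearMap.ker_eq_bot']
    intro a ha
    exact Subtype.ext (hf a a.2 ha)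
  have hi2 := TensorProduct.map_injective_of_flat_flat (f.comp X.subtype) (f.comp X.subtype) hi hi
  rw [← LinearMap.comp_apply, ← TensorProduct.map_comp] at h0
  rw [hi2 (h0.trans (map_zero _).symm), map_zero]

theorem delta_counit (z : TensorAlgebra k V ⊗[k] TensorAlgebra k V) :
    TensorProduct.map
      ((TensorProduct.rid k _).toLinearMap.comp (TensorProduct.map LinearMap.id (eps k V)))
      ((TensorProduct.lid k _).toLinearMap.comp (TensorProduct.map (eps k V) LinearMap.id))
      (delta k V z) = z := by
  have key := fun d => tens_ind2 (M := TensorAlgebra k V ⊗[k] TensorAlgebra k V)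
    (f := (TensorProduct.map
      ((TensorProduct.rid k _).toLinearMap.comp (TensorProduct.map LinearMap.id (eps k V)))
      ((TensorProduct.lid k _).toLinearMap.comp (TensorProduct.map (eps k V) LinearMap.id))).comp
      (TensorProduct.tensorTensorTensorComm k (TensorAlgebra k V) (TensorAlgebra k V)
        (TensorAlgebra k V) (TensorAlgebra k V)).toLinearMap)
    (g := TensorProduct.map
      ((TensorProduct.rid k _).toLinearMap.comp (TensorProduct.map LinearMap.id (eps k V)))
      ((TensorProduct.lid k _).toLinearMap.comp (TensorProduct.map (eps k V) LinearMap.id)))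
    (by
      intro a b c d
      simp [TensorProduct.smul_tmul, TensorProduct.tmul_smul, smul_smul, mul_comm]) d
  induction z with
  | zero => simp
  | add x y hx hy => simp only [map_add, hx, hy]
  | tmul a b =>
    refine (key (psi k V a ⊗ₜ psi k V b)).trans ?_
    rw [TensorProduct.map_tmul]
    congr 1
    · exact psi_eps a
    · exact eps_psi b

theorem mul_inj (hP : SubCo P) (hQ : SubCo Q)
    (hPQ : ∀ x ∈ P, x ∈ Q → x = eps k V x • 1) (n : ℕ) :
    ∀ z ∈ Nn P Q n, LinearMap.mul' k _ z = 0 → z = 0 := by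
  induction n with
  | zero =>
    have hN : Nn P Q 0 ≤ Submodule.span k {(1 : TensorAlgebra k V) ⊗ₜ[k] (1 : TensorAlgebra k V)} := by
      refine Submodule.span_le.2 ?_
      rintro z ⟨i, j, hij, a, ha, b, hb, rfl⟩
      obtain rfl : i = 0 := by omega
      obtain rfl : j = 0 := by omega
      obtain ⟨c, rfl⟩ := Fil_zero_mem ha.2
      obtain ⟨d, rfl⟩ := Fil_zero_mem hb.2
      rw [TensorProduct.tmul_smul, ← TensorProduct.smul_tmul']
      exact Submodule.smul_mem _ _ (Submodule.smul_mem _ _ (Submodule.subset_span rfl))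
    intro z hz h0
    obtain ⟨c, rfl⟩ := Submodule.mem_span_singleton.1 (hN hz)
    have h1 := congrArg (eps k V) h0
    rw [map_smul, LinearMap.mul'_apply, mul_one, map_smul, eps_one, map_zero, smul_eq_mul,
      mul_one] at h1
    rw [h1, zero_smul]
  | succ n ih =>
    intro z hz h0
    obtain ⟨w, hw, e⟩ := delta_split hP hQ n hz
    have h1 : TensorProduct.map (LinearMap.mul' k (TensorAlgebra k V))
        (LinearMap.mul' k (TensorAlgebra k V)) w = 0 := by
      have h2 := psi_mul' z
      rw [h0, map_zero, e] at h2
      simpa [h0] using h2.symm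
    have hw0 := tens_inj ih hw h1
    rw [hw0, add_zero] at e
    have h3 := delta_counit z
    rw [e] at h3
    have hzt := Nn_le_tens _ hz
    have hb : TensorProduct.rid k _ (TensorProduct.map LinearMap.id (eps k V) z) ∈ P := by
      refine tens_maps (f := (TensorProduct.rid k _).toLinearMap.comp
        (TensorProduct.map LinearMap.id (eps k V))) ?_ hzt
      intro a ha b _
      simpa using Submodule.smul_mem _ _ ha
    have hc : TensorProduct.lid k _ (TensorProduct.map (eps k V) LinearMap.id z) ∈ Q := by
      refine tens_maps (f := (TensorProduct.lid k _).toLinearMap.comp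
        (TensorProduct.map (eps k V) LinearMap.id)) ?_ hzt
      intro a _ b hb
      simpa using Submodule.smul_mem _ _ hb
    simp only [map_add, TensorProduct.map_tmul, LinearMap.comp_apply, LinearEquiv.coe_coe,
      LinearMap.id_apply, eps_one, TensorProduct.rid_tmul, TensorProduct.lid_tmul, one_smul] at h3
    revert hb hc h3
    generalize TensorProduct.rid k _ (TensorProduct.map LinearMap.id (eps k V) z) = b
    generalize TensorProduct.lid k _ (TensorProduct.map (eps k V) LinearMap.id z) = c
    intro hb hc h3
    have h4 : b + c = 0 := by
      rw [← h0, ← h3]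
      simp
    have h5 : b = -c := eq_neg_of_add_eq_zero_left h4
    have h6 : c ∈ P := by
      rw [h5] at hb
      simpa using hb
    have h7 := hPQ c h6 hc
    rw [← h3, h5, h7, TensorProduct.neg_tmul, TensorProduct.tmul_smul,
      ← TensorProduct.smul_tmul', neg_add_cancel]

end Inj

/-- Let `B(V)` be a natural sub-Hopf algebra of `T(V)` over a field of characteristic `p`.  If
there is a natural linear retraction `r : T(V) → B(V)` and each indecomposables functor
`Q_nB = (IB ∩ T_n)/(IB ∩ T_n ∩ (IB)²)` is a natural retract of a free `T_n`-functor, then the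
inclusion `B(V) ⊆ T(V)` admits a natural coalgebra retraction (so `B` is natural
coalgebra-split) and `T(V) ≅ B(V) ⊗ C(V)` as coalgebras for a natural subcoalgebra functor `C`,
the isomorphism being multiplication. -/
theorem stmt19 (k : Type) [Field k] (p : ℕ) [Fact p.Prime] [CharP k p]
    (S : ∀ (V : Type) [AddCommGroup V] [Module k V], Subalgebra k (TensorAlgebra k V))
    -- B is a natural sub-Hopf algebra
    (hhopf : ∀ (V : Type) [AddCommGroup V] [Module k V], ∀ x ∈ S V,
      psi k V x ∈ Submodule.span k
        {z : TensorAlgebra k V ⊗[k] TensorAlgebra k V |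
          ∃ a ∈ S V, ∃ b ∈ S V, z = a ⊗ₜ[k] b})
    (hnat : ∀ (V W : Type) [AddCommGroup V] [Module k V] [AddCommGroup W] [Module k W]
      (f : V →ₗ[k] W), Subalgebra.map (Tmap k f) (S V) ≤ S W)
    -- a natural linear retraction r : T(V) → B(V)
    (r : ∀ (V : Type) [AddCommGroup V] [Module k V],
        TensorAlgebra k V →ₗ[k] TensorAlgebra k V)
    (hrrange : ∀ (V : Type) [AddCommGroup V] [Module k V],
        LinearMap.range (r V) = Subalgebra.toSubmodule (S V))
    (hrfix : ∀ (V : Type) [AddCommGroup V] [Module k V], ∀ x ∈ S V, r V x = x)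
    (hrnat : ∀ (V W : Type) [AddCommGroup V] [Module k V] [AddCommGroup W] [Module k W]
      (f : V →ₗ[k] W),
      (r W).comp (Tmap k f).toLinearMap = (Tmap k f).toLinearMap.comp (r V))
    -- the augmentation ideal IB(V) = B(V) ∩ ker ε, and the degree-n part P_n of IB
    (IB : ∀ (V : Type) [AddCommGroup V] [Module k V], Submodule k (TensorAlgebra k V))
    (hIB : ∀ (V : Type) [AddCommGroup V] [Module k V],
        IB V = Subalgebra.toSubmodule (S V) ⊓ LinearMap.ker (eps k V))
    (Pn : ∀ (n : ℕ) (V : Type) [AddCommGroup V] [Module k V],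
        Submodule k (TensorAlgebra k V))
    (hPn : ∀ (n : ℕ) (V : Type) [AddCommGroup V] [Module k V],
        Pn n V = IB V ⊓ Tpiece k V n)
    -- each Q_nB = P_n/(P_n ∩ (IB)²) is a natural retract of a free T_n-functor
    (hQproj : ∀ n : ℕ, ∃ (ι : Type)
        (s : ∀ (V : Type) [AddCommGroup V] [Module k V],
          (Pn n V ⧸ Submodule.comap (Pn n V).subtype (IB V * IB V)) →ₗ[k]
            (ι →₀ Tpiece k V n))
        (t : ∀ (V : Type) [AddCommGroup V] [Module k V],
          (ι →₀ Tpiece k V n) →ₗ[k]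
            (Pn n V ⧸ Submodule.comap (Pn n V).subtype (IB V * IB V))),
      (∀ (V : Type) [AddCommGroup V] [Module k V]
          (y : Pn n V ⧸ Submodule.comap (Pn n V).subtype (IB V * IB V)), t V (s V y) = y) ∧
      -- naturality of s
      (∀ (V W : Type) [AddCommGroup V] [Module k V] [AddCommGroup W] [Module k W]
          (f : V →ₗ[k] W) (x : Pn n V) (h : Tmap k f ↑x ∈ Pn n W) (j : ι),
          (↑(s W (Submodule.Quotient.mk ⟨Tmap k f ↑x, h⟩) j) : TensorAlgebra k W)
            = Tmap k f ↑(s V (Submodule.Quotient.mk x) j)) ∧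
      -- naturality of t
      (∀ (V W : Type) [AddCommGroup V] [Module k V] [AddCommGroup W] [Module k W]
          (f : V →ₗ[k] W) (y : ι →₀ Tpiece k V n) (y' : ι →₀ Tpiece k W n),
          (∀ j : ι, (↑(y' j) : TensorAlgebra k W) = Tmap k f ↑(y j)) →
          ∀ (x : Pn n V) (h : Tmap k f ↑x ∈ Pn n W),
            Submodule.Quotient.mk x = t V y →
            t W y' = Submodule.Quotient.mk (⟨Tmap k f ↑x, h⟩ : Pn n W))) :
    -- (A) the inclusion B(V) → T(V) admits a natural coalgebra retraction
    (∃ ρ : ∀ (V : Type) [AddCommGroup V] [Module k V],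
        TensorAlgebra k V →ₗ[k] TensorAlgebra k V,
      (∀ (V : Type) [AddCommGroup V] [Module k V],
        LinearMap.range (ρ V) = Subalgebra.toSubmodule (S V)) ∧
      (∀ (V : Type) [AddCommGroup V] [Module k V], ∀ x ∈ S V, ρ V x = x) ∧
      -- ρ is a coalgebra map
      (∀ (V : Type) [AddCommGroup V] [Module k V],
        (psi k V).toLinearMap.comp (ρ V)
          = (TensorProduct.map (ρ V) (ρ V)).comp (psi k V).toLinearMap) ∧
      (∀ (V : Type) [AddCommGroup V] [Module k V], (eps k V).comp (ρ V) = eps k V) ∧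
      -- ρ is natural
      (∀ (V W : Type) [AddCommGroup V] [Module k V] [AddCommGroup W] [Module k W]
        (f : V →ₗ[k] W),
        (ρ W).comp (Tmap k f).toLinearMap = (Tmap k f).toLinearMap.comp (ρ V))) ∧
    -- (B) T(V) ≅ B(V) ⊗ C(V) as coalgebras, via multiplication, for a natural subcoalgebra C
    (∃ C : ∀ (V : Type) [AddCommGroup V] [Module k V], Submodule k (TensorAlgebra k V),
      (∀ (V : Type) [AddCommGroup V] [Module k V], (1 : TensorAlgebra k V) ∈ C V) ∧
      -- C is a subcoalgebra
      (∀ (V : Type) [AddCommGroup V] [Module k V], ∀ x ∈ C V,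
        psi k V x ∈ Submodule.span k
          {z : TensorAlgebra k V ⊗[k] TensorAlgebra k V |
            ∃ a ∈ C V, ∃ b ∈ C V, z = a ⊗ₜ[k] b}) ∧
      -- C is natural
      (∀ (V W : Type) [AddCommGroup V] [Module k V] [AddCommGroup W] [Module k W]
        (f : V →ₗ[k] W), Submodule.map (Tmap k f).toLinearMap (C V) ≤ C W) ∧
      -- multiplication B(V) ⊗ C(V) → T(V) is a linear (hence coalgebra) isomorphism
      (∀ (V : Type) [AddCommGroup V] [Module k V]
        (Bm Cm : Type) [AddCommGroup Bm] [Module k Bm] [AddCommGroup Cm] [Module k Cm]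
        (uB : Bm →ₗ[k] TensorAlgebra k V) (uC : Cm →ₗ[k] TensorAlgebra k V),
        Function.Injective uB → LinearMap.range uB = Subalgebra.toSubmodule (S V) →
        Function.Injective uC → LinearMap.range uC = C V →
        Function.Bijective
          ((LinearMap.mul' k (TensorAlgebra k V)).comp (TensorProduct.map uB uC)))) := by
  have hR : IsNatural (k := k) r := fun V W _ _ _ _ f x => LinearMap.congr_fun (hrnat V W f) x
  have hD : ∀ (V : Type) [AddCommGroup V] [Module k V], RetData (S V) (r V) := by
    intro V _ _
    refine ⟨fun x => ?_, hrfix V, fun n x hx => hR.fil hx, fun x hx => ?_⟩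
    · have : r V x ∈ LinearMap.range (r V) := ⟨x, rfl⟩
      rw [hrrange V] at this
      exact this
    · rw [tens_eq_span]
      exact hhopf V x hx
  have hN : IsNatural (k := k) (fun V _ _ => rho (r V)) := fun V W _ _ _ _ f x =>
    (hD V).rho_nat (hD W) f (hR V W f) x
  have hD' : ∀ (V : Type) [AddCommGroup V] [Module k V], RetData (S V) (rho (r V)) := by
    intro V _ _
    exact ⟨(hD V).rho_mem, fun x hx => (hD V).rho_fix hx, fun n x hx => hN.fil hx, (hD V).cop⟩
  have hC : ∀ (V : Type) [AddCommGroup V] [Module k V], CoEnd (rho (r V)) := by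
    intro V _ _
    exact ⟨fun n x hx => hN.fil hx, (hD V).rho_coalg, (hD V).rho_eps,
      (hD V).rho_fix (S V).one_mem⟩
  have hPN : IsNatural (k := k) (fun V _ _ => Phi (rho (r V))) := by
    intro V W _ _ _ _ f x
    refine conv_nat f (fun y => ?_) (fun y => rfl) x
    rw [LinearMap.comp_apply, LinearMap.comp_apply, ← Sa_nat]
    exact congrArg _ (hN V W f y)
  have hP : ∀ (V : Type) [AddCommGroup V] [Module k V], CoEnd (Phi (rho (r V))) := by
    intro V _ _
    refine ⟨fun n x hx => hPN.fil hx, ?_, ?_, ?_⟩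
    · refine conv_coalg (fun x => ?_) (fun x => ?_)
      · rw [LinearMap.comp_apply, Sa_psi, (hC V).coalg, TensorProduct.map_comp]
        rfl
      · rw [TensorProduct.map_id]
        rfl
    · refine conv_eps (fun x => ?_) (fun x => rfl)
      rw [LinearMap.comp_apply, Sa_eps, (hC V).eps]
    · simp [Phi, conv_apply, Algebra.TensorProduct.one_def, Sa_one, (hC V).one]
  refine ⟨⟨fun V _ _ => rho (r V), ?_, fun V _ _ x hx => (hD V).rho_fix hx, ?_, ?_, ?_⟩,
    ⟨fun V _ _ => Cc (rho (r V)), fun V _ _ => (hP V).one, ?_, ?_, ?_⟩⟩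
  · intro V _ _
    refine le_antisymm ?_ fun x hx => ⟨x, (hD V).rho_fix hx⟩
    rintro _ ⟨x, rfl⟩
    exact (hD V).rho_mem x
  · intro V _ _
    exact LinearMap.ext (hD V).rho_coalg
  · intro V _ _
    exact LinearMap.ext (hD V).rho_eps
  · intro V W _ _ _ _ f
    exact LinearMap.ext (hN V W f)
  · intro V _ _ x hx
    rw [← tens_eq_span]
    exact C_cop (hD' V) (hC V) (hP V) hx
  · rintro V W _ _ _ _ f _ ⟨x, hx, rfl⟩
    have h1 : Phi (rho (r V)) x = x := hx
    have h2 := hPN V W f x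
    rw [mem_Cc]
    refine h2.trans ?_
    change Tmap k f (Phi (rho (r V)) x) = Tmap k f x
    rw [h1]
  · intro V _ _ Bm Cm _ _ _ _ uB uC hB hBr hCi hCr
    have hrange : LinearMap.range (TensorProduct.map uB uC) =
        tens (Subalgebra.toSubmodule (S V)) (Cc (rho (r V))) := by
      rw [TensorProduct.range_map, hBr, hCr, tens]
    have hinj : Function.Injective (TensorProduct.map uB uC) :=
      TensorProduct.map_injective_of_flat_flat _ _ hB hCi
    constructor
    · rw [← LinearMap.ker_eq_bot, LinearMap.ker_eq_bot']
      intro z hz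
      have hm : TensorProduct.map uB uC z ∈
          tens (Subalgebra.toSubmodule (S V)) (Cc (rho (r V))) := by
        rw [← hrange]
        exact ⟨z, rfl⟩
      obtain ⟨n, hn⟩ := mem_Nn_of_tens hm
      have h0 := mul_inj (P := Subalgebra.toSubmodule (S V)) (Q := Cc (rho (r V)))
        ⟨(S V).one_mem, fun n x hx hn => (hD V).split hx hn⟩
        ⟨(hP V).one, fun n x hx hn => C_split (hD' V) (hC V) (hP V) hx hn⟩
        (fun x hx hx' => by
          rw [← rho_C (hD' V) (hC V) (hP V) hx', (hD V).rho_fix hx]) n _ hn hz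
      exact hinj (by rw [h0, map_zero])
    · intro y
      obtain ⟨n, hn⟩ := Fil_exhaust y
      obtain ⟨z, hz, rfl⟩ := surj_mul (hD' V) (hC V) (hP V) n hn
      have hz' : z ∈ LinearMap.range (TensorProduct.map uB uC) := by
        rw [hrange]
        exact hz
      obtain ⟨w, rfl⟩ := hz'
      exact ⟨w, rfl⟩
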